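/- Assume (P₂) and (Q₂). Let {u_n} be a bounded sequence in W^{s,p(·,·)}(ℝ^N) such that u_n ⇀ u weakly in W^{s,p(·,·)}(ℝ^N), the functions U_n(x) := |u_n(x)|^{p̄} + ∫_{ℝ^N} |u_n(x)−u_n(y)|^{p(x,y)}/|x−y|^{N+s·p(x,y)} dy converge weakly-* to a finite Radon measure μ, and |u_n|^{q(x)} converges weakly-* to a finite Radon measure ν. Then there exist an at most countable index set I, distinct points {x_i}_{i∈I} contained in the critical set C = {x : q(x) = p̄_s^*}, and positive numbers {μ_i}_{i∈I}, {ν_i}_{i∈I} such that: (i) μ ≥ (|u(x)|^{p̄} + ∫_{ℝ^N} |u(x)−u(y)|^{p(x,y)}/|x−y|^{N+s·p(x,y)} dy) dx + Σ_{i∈I} μ_i δ_{x_i}; (ii) ν = |u(x)|^{q(x)} dx + Σ_{i∈I} ν_i δ_{x_i}; (iii) S_q · ν_i^{1/p̄_s^*} ≤ μ_i^{1/p̄} for every i ∈ I. -/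

import Mathlib

open MeasureTheory Filter Topology Set
open scoped ENNReal NNReal

noncomputable section

/-- Euclidean space `ℝ^N`. -/
abbrev Euc (N : ℕ) := EuclideanSpace ℝ (Fin N)

/-- The modular of the variable exponent Lebesgue space `L^{h(·)}_μ`. -/
def varModular {α : Type*} [MeasurableSpace α] (μ : Measure α) (h : α → ℝ) (u : α → ℝ) : ℝ≥0∞ :=
  ∫⁻ x, ENNReal.ofReal (|u x| ^ (h x)) ∂μ

/-- The Luxemburg norm on the variable exponent Lebesgue space `L^{h(·)}_μ`. -/
def luxNorm {α : Type*} [MeasurableSpace α] (μ : Measure α) (h : α → ℝ) (u : α → ℝ) : ℝ :=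
  sInf {c : ℝ | 0 < c ∧ varModular μ h (fun x => u x / c) ≤ 1}

/-- Membership in the variable exponent Lebesgue space `L^{h(·)}_μ`. -/
def MemVarLp {α : Type*} [MeasurableSpace α] (μ : Measure α) (h : α → ℝ) (u : α → ℝ) : Prop :=
  AEStronglyMeasurable u μ ∧ varModular μ h u < ⊤

/-- The integrand of the Gagliardo-type seminorm with variable exponent. -/
def sobKernel {N : ℕ} (s : ℝ) (p : Euc N → Euc N → ℝ) (u : Euc N → ℝ) (x y : Euc N) : ℝ≥0∞ :=
  ENNReal.ofReal (|u x - u y| ^ (p x y) / dist x y ^ ((N : ℝ) + s * p x y))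

/-- The modular of the fractional Sobolev space `W^{s,p(·,·)}(Ω)`. -/
def sobModular {N : ℕ} (Ω : Set (Euc N)) (s : ℝ) (p : Euc N → Euc N → ℝ)
    (u : Euc N → ℝ) : ℝ≥0∞ :=
  (∫⁻ x in Ω, ENNReal.ofReal (|u x| ^ (p x x))) + ∫⁻ x in Ω, ∫⁻ y in Ω, sobKernel s p u x y

/-- The Luxemburg-type norm of the fractional Sobolev space `W^{s,p(·,·)}(Ω)`. -/
def sobNorm {N : ℕ} (Ω : Set (Euc N)) (s : ℝ) (p : Euc N → Euc N → ℝ) (u : Euc N → ℝ) : ℝ :=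
  sInf {c : ℝ | 0 < c ∧ sobModular Ω s p (fun x => u x / c) ≤ 1}

/-- Membership in the fractional Sobolev space `W^{s,p(·,·)}(Ω)`. -/
def MemSob {N : ℕ} (Ω : Set (Euc N)) (s : ℝ) (p : Euc N → Euc N → ℝ) (u : Euc N → ℝ) : Prop :=
  AEStronglyMeasurable u (volume.restrict Ω) ∧ sobModular Ω s p u < ⊤

/-- The best constant `S_q` of the imbedding `W^{s,p(·,·)}(ℝ^N) ↪ L^{q(·)}(ℝ^N)`. -/
def Sq {N : ℕ} (s : ℝ) (p : Euc N → Euc N → ℝ) (q : Euc N → ℝ) : ℝ :=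
  sInf {c : ℝ | ∃ u : Euc N → ℝ, MemSob Set.univ s p u ∧ ¬ u =ᵐ[volume] 0 ∧
    c = sobNorm Set.univ s p u / luxNorm volume q u}

/-- A bounded linear functional on `W^{s,p(·,·)}(ℝ^N)`, described by its action on functions. -/
def IsBddLinFunc {N : ℕ} (s : ℝ) (p : Euc N → Euc N → ℝ) (T : (Euc N → ℝ) → ℝ) : Prop :=
  (∀ f g : Euc N → ℝ, MemSob Set.univ s p f → MemSob Set.univ s p g →
      T (f + g) = T f + T g) ∧
  (∀ (c : ℝ) (f : Euc N → ℝ), MemSob Set.univ s p f → T (c • f) = c * T f) ∧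
  ∃ C : ℝ, ∀ f : Euc N → ℝ, MemSob Set.univ s p f → |T f| ≤ C * sobNorm Set.univ s p f

/-- Weak convergence in `W^{s,p(·,·)}(ℝ^N)`. -/
def WeakConvSob {N : ℕ} (s : ℝ) (p : Euc N → Euc N → ℝ)
    (un : ℕ → Euc N → ℝ) (u : Euc N → ℝ) : Prop :=
  ∀ T : (Euc N → ℝ) → ℝ, IsBddLinFunc s p T →
    Tendsto (fun n => T (un n)) atTop (𝓝 (T u))

/-- Weak-* convergence of a sequence of integrable functions to a finite Radon measure:
testing against continuous functions vanishing at infinity. -/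
def WeakStarConv {N : ℕ} (f : ℕ → Euc N → ℝ) (μ : Measure (Euc N)) : Prop :=
  ∀ φ : Euc N → ℝ, Continuous φ → Tendsto φ (cocompact (Euc N)) (𝓝 0) →
    Tendsto (fun n => ∫ x, φ x * f n x) atTop (𝓝 (∫ x, φ x ∂μ))

/-- `U(x) = |u(x)|^{p̄} + ∫_{ℝ^N} |u(x)-u(y)|^{p(x,y)} / |x-y|^{N+s·p(x,y)} dy`. -/
def Ufun {N : ℕ} (s : ℝ) (p : Euc N → Euc N → ℝ) (pbar : ℝ) (u : Euc N → ℝ) (x : Euc N) : ℝ :=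
  |u x| ^ pbar + (∫⁻ y, sobKernel s p u x y).toReal

set_option linter.unusedVariables false

lemma holder_one {α : Type*} [MeasurableSpace α] (μ : Measure α) {a : ℝ} (ha : 1 < a)
    {h : α → ℝ≥0∞} (hh : AEMeasurable h μ) :
    ∫⁻ x, h x ∂μ ≤ (∫⁻ x, h x ^ a ∂μ) ^ (1 / a) * μ univ ^ (1 - 1 / a) := by
  have hc := Real.HolderConjugate.conjExponent ha
  have h2 := ENNReal.lintegral_mul_le_Lp_mul_Lq μ hc hh (g := fun _ => 1) aemeasurable_const
  have h3 : 1 / a.conjExponent = 1 - 1 / a := by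
    have := hc.inv_add_inv_eq_one
    rw [one_div, one_div]; linarith
  simpa [h3] using h2

/-- near-diagonal kernel with constant exponent -/
def nk {N : ℕ} (s r e : ℝ) (f : Euc N → ℝ) (x y : Euc N) : ℝ≥0∞ :=
  if dist x y < e then ENNReal.ofReal (|f x - f y| ^ r / dist x y ^ ((N : ℝ) + s * r)) else 0

def Gf {N : ℕ} (s r e : ℝ) (f : Euc N → ℝ) (x : Euc N) : ℝ≥0∞ :=
  ENNReal.ofReal (|f x| ^ r) + ∫⁻ y, nk s r e f x y

lemma measurable_nk {N : ℕ} (s r e : ℝ) {f : Euc N → ℝ} (hf : Measurable f) :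
    Measurable (fun z : Euc N × Euc N => nk s r e f z.1 z.2) := by
  unfold nk
  refine Measurable.ite ?_ ?_ measurable_const
  · exact measurableSet_lt (by fun_prop) measurable_const
  · fun_prop

lemma measurable_Gf {N : ℕ} (s r e : ℝ) {f : Euc N → ℝ} (hf : Measurable f) :
    Measurable (Gf s r e f) := by
  unfold Gf
  have h0 : Measurable (fun x => ENNReal.ofReal (|f x| ^ r)) := by fun_prop
  refine h0.add ?_
  exact Measurable.lintegral_prod_right' (measurable_nk s r e hf)

lemma ball_diff_bound {N : ℕ} {s r e ε : ℝ} (hs : 0 < s) (hr : 1 < r) (hε : 0 < ε) (hεe : ε ≤ e)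
    (f : Euc N → ℝ) (x : Euc N) :
    ∫⁻ y in Metric.ball x ε, ENNReal.ofReal (|f x - f y| ^ r) ≤
      ENNReal.ofReal (ε ^ ((N : ℝ) + s * r)) * ∫⁻ y, nk s r e f x y := by
  rw [← lintegral_const_mul' _ _ ENNReal.ofReal_ne_top]
  calc _ ≤ ∫⁻ y in Metric.ball x ε, ENNReal.ofReal (ε ^ ((N : ℝ) + s * r)) * nk s r e f x y := by
        refine setLIntegral_mono' measurableSet_ball fun y hy => ?_
        rw [Metric.mem_ball, dist_comm] at hy
        rw [nk, if_pos (hy.trans_le hεe), ← ENNReal.ofReal_mul (by positivity)]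
        apply ENNReal.ofReal_le_ofReal
        rcases eq_or_ne x y with rfl | hxy
        · simp [Real.zero_rpow (by linarith : r ≠ 0)]
        · have hd : 0 < dist x y := dist_pos.2 hxy
          have h1 : dist x y ^ ((N : ℝ) + s * r) ≤ ε ^ ((N : ℝ) + s * r) :=
            Real.rpow_le_rpow hd.le hy.le (by positivity)
          have h2 : 0 < dist x y ^ ((N : ℝ) + s * r) := Real.rpow_pos_of_pos hd _
          rw [mul_div_assoc', le_div_iff₀ h2, mul_comm]
          exact mul_le_mul_of_nonneg_right h1 (by positivity)
    _ ≤ _ := setLIntegral_le_lintegral _ _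

lemma vol_ball {N : ℕ} (hN : 0 < N) (x : Euc N) {ε : ℝ} (hε : 0 < ε) :
    volume (Metric.ball x ε) = ENNReal.ofReal (ε ^ (N : ℝ) * (volume (Metric.ball (0 : Euc N) 1)).toReal) := by
  have : Nonempty (Fin N) := ⟨⟨0, hN⟩⟩
  rw [Measure.addHaar_ball volume x hε.le, finrank_euclideanSpace_fin,
    ENNReal.ofReal_mul (by positivity), ENNReal.ofReal_toReal measure_ball_lt_top.ne, Real.rpow_natCast]

lemma real_opt {n s r rs t g F A B : ℝ} (hn : 0 < n) (hs : 0 < s) (hr : 1 < r) (hsr : s * r < n)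
    (hrs : rs = n * r / (n - s * r)) (ht : 0 ≤ t) (hg : 0 < g) (hF : 0 < F) (hA : 0 ≤ A) (hB : 0 ≤ B)
    (h : ∀ ε : ℝ, 0 < ε → t ≤ A * ε ^ s * g + B * ε ^ (-(n / rs)) * F) :
    t ^ rs ≤ (A + B) ^ rs * (g ^ r * F ^ (rs - r)) := by
  have hd : 0 < n - s * r := by linarith
  have hrs0 : 0 < rs := by rw [hrs]; positivity
  set ε := (F / g) ^ (r / n) with hεd
  have hε : 0 < ε := by positivity
  have h1 := h ε hε
  have e1 : ε ^ s * g = g ^ (1 - s * r / n) * F ^ (s * r / n) := by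
    rw [hεd, ← Real.rpow_mul (by positivity), Real.div_rpow hF.le hg.le, Real.rpow_sub hg, Real.rpow_one,
      show r / n * s = s * r / n by ring]
    field_simp
  have e2 : ε ^ (-(n / rs)) * F = g ^ (1 - s * r / n) * F ^ (s * r / n) := by
    have : r / n * (-(n / rs)) = -(1 - s * r / n) := by
      rw [hrs]; field_simp
    rw [hεd, ← Real.rpow_mul (by positivity), this, Real.rpow_neg (by positivity), Real.div_rpow hF.le hg.le,
      inv_div, show s * r / n = 1 - (1 - s * r / n) by ring, Real.rpow_sub hF, Real.rpow_one]
    simp only [sub_sub_cancel]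
    field_simp
  have h2 : t ≤ (A + B) * (g ^ (1 - s * r / n) * F ^ (s * r / n)) := by
    rw [mul_assoc, mul_assoc, e1, e2] at h1; linarith
  calc t ^ rs ≤ ((A + B) * (g ^ (1 - s * r / n) * F ^ (s * r / n))) ^ rs :=
        Real.rpow_le_rpow ht h2 hrs0.le
    _ = _ := by
      rw [Real.mul_rpow (by positivity) (by positivity), Real.mul_rpow (by positivity) (by positivity),
        ← Real.rpow_mul hg.le, ← Real.rpow_mul hF.le]
      congr 3
      · rw [hrs]; field_simp
      · rw [hrs]; field_simp; ring

lemma ofReal_rpow' (t a : ℝ) (ha : 0 ≤ a) : ENNReal.ofReal (|t| ^ a) = ENNReal.ofReal |t| ^ a :=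
  (ENNReal.ofReal_rpow_of_nonneg (abs_nonneg t) ha).symm

/-- pointwise bound -/
lemma ptwise {N : ℕ} (hN : 0 < N) {s r e rs : ℝ} (hs : 0 < s) (hr : 1 < r) (hrs1 : 1 < rs) (he : 0 < e)
    {f : Euc N → ℝ} (hf : Measurable f) (x : Euc N) {w g F ε : ℝ}
    (hw : w = (volume (Metric.ball (0 : Euc N) 1)).toReal)
    (hg : 0 ≤ g) (hF : 0 ≤ F) (hG : Gf s r e f x = ENNReal.ofReal (g ^ r))
    (hFF : ∫⁻ y, ENNReal.ofReal (|f y| ^ rs) = ENNReal.ofReal (F ^ rs)) (hε : 0 < ε) :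
    |f x| ≤ (w ^ (-(1 / r)) + e ^ (-s)) * ε ^ s * g + w ^ (-(1 / rs)) * ε ^ (-((N : ℝ) / rs)) * F := by
  have hw0 : 0 < w := by
    rw [hw]; exact ENNReal.toReal_pos (Metric.measure_ball_pos _ _ one_pos).ne' measure_ball_lt_top.ne
  rcases le_or_gt ε e with hεe | hεe
  · -- averaging
    obtain ⟨b, hb⟩ : ∃ b, b = ε ^ (N : ℝ) * w := ⟨_, rfl⟩
    have hb0 : 0 < b := by rw [hb]; positivity
    have hvol : volume (Metric.ball x ε) = ENNReal.ofReal b := by rw [vol_ball hN x hε, hb, hw]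
    have k1 : ENNReal.ofReal (b * |f x|) ≤ ∫⁻ y in Metric.ball x ε, ENNReal.ofReal |f x - f y| +
        ENNReal.ofReal |f y| := by
      calc ENNReal.ofReal (b * |f x|) = ∫⁻ y in Metric.ball x ε, ENNReal.ofReal |f x| := by
            rw [setLIntegral_const, hvol, ENNReal.ofReal_mul hb0.le, mul_comm]
        _ ≤ _ := by
            refine lintegral_mono fun y => ?_
            rw [← ENNReal.ofReal_add (abs_nonneg _) (abs_nonneg _)]
            apply ENNReal.ofReal_le_ofReal
            calc |f x| = |(f x - f y) + f y| := by ring_nf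
              _ ≤ _ := abs_add_le _ _
    rw [lintegral_add_left (by fun_prop)] at k1
    have k2 : ∫⁻ y in Metric.ball x ε, ENNReal.ofReal |f x - f y| ≤
        ENNReal.ofReal ((ε ^ ((N : ℝ) + s * r) * g ^ r) ^ (1 / r) * b ^ (1 - 1 / r)) := by
      refine (holder_one _ hr (by fun_prop)).trans ?_
      rw [Measure.restrict_apply_univ, hvol, ENNReal.ofReal_mul (by positivity),
        ← ENNReal.ofReal_rpow_of_pos hb0,
        ← ENNReal.ofReal_rpow_of_nonneg (by positivity) (by positivity)]
      gcongr
      simp_rw [← ofReal_rpow' _ _ (by linarith : 0 ≤ r)]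
      refine (ball_diff_bound hs hr hε hεe f x).trans ?_
      rw [ENNReal.ofReal_mul (by positivity), ← hG, Gf]
      gcongr
      exact le_add_self
    have k3 : ∫⁻ y in Metric.ball x ε, ENNReal.ofReal |f y| ≤
        ENNReal.ofReal (F * b ^ (1 - 1 / rs)) := by
      refine (holder_one _ hrs1 (by fun_prop)).trans ?_
      rw [Measure.restrict_apply_univ, hvol, ENNReal.ofReal_mul (by positivity),
        ← ENNReal.ofReal_rpow_of_pos hb0]
      gcongr
      simp_rw [← ofReal_rpow' _ _ (by linarith : 0 ≤ rs)]
      calc _ ≤ (ENNReal.ofReal (F ^ rs)) ^ (1 / rs) := by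
            rw [← hFF]; gcongr; exact Measure.restrict_le_self
        _ = _ := by
            rw [ENNReal.ofReal_rpow_of_nonneg (by positivity) (by positivity), ← Real.rpow_mul hF,
              mul_one_div_cancel (by linarith), Real.rpow_one]
    have k4 := k1.trans (add_le_add k2 k3)
    rw [← ENNReal.ofReal_add (by positivity) (by positivity),
      ENNReal.ofReal_le_ofReal_iff (by positivity)] at k4
    have k5 : |f x| ≤ ((ε ^ ((N : ℝ) + s * r) * g ^ r) ^ (1 / r) * b ^ (1 - 1 / r) + F * b ^ (1 - 1 / rs)) / b := by
      rw [le_div_iff₀ hb0, mul_comm]; exact k4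
    have k6 : (ε ^ ((N : ℝ) + s * r) * g ^ r) ^ (1 / r) * b ^ (1 - 1 / r) / b = w ^ (-(1 / r)) * ε ^ s * g := by
      rw [Real.mul_rpow (by positivity) (by positivity), ← Real.rpow_mul hε.le, ← Real.rpow_mul hg,
        mul_one_div_cancel (by linarith), Real.rpow_one, Real.rpow_sub hb0, Real.rpow_one, hb,
        Real.mul_rpow (by positivity) (by positivity), ← Real.rpow_mul hε.le,
        Real.rpow_neg hw0.le, show ((N : ℝ) + s * r) * (1 / r) = N * (1 / r) + s by field_simp,
        Real.rpow_add hε]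
      field_simp
    have k7 : F * b ^ (1 - 1 / rs) / b = w ^ (-(1 / rs)) * ε ^ (-((N : ℝ) / rs)) * F := by
      rw [Real.rpow_sub hb0, Real.rpow_one, hb, Real.mul_rpow (by positivity) (by positivity),
        ← Real.rpow_mul hε.le, Real.rpow_neg hw0.le, Real.rpow_neg hε.le, mul_one_div]
      field_simp
    rw [add_div, k6, k7] at k5
    have : 0 ≤ e ^ (-s) * ε ^ s * g := by positivity
    nlinarith
  · have h1 : |f x| ≤ g := by
      have : ENNReal.ofReal (|f x| ^ r) ≤ ENNReal.ofReal (g ^ r) := by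
        rw [← hG, Gf]; exact le_self_add
      rw [ENNReal.ofReal_le_ofReal_iff (by positivity)] at this
      exact (Real.rpow_le_rpow_iff (abs_nonneg _) hg (by linarith)).1 this
    have h2 : 1 ≤ e ^ (-s) * ε ^ s := by
      rw [Real.rpow_neg he.le, ← div_eq_inv_mul, one_le_div (by positivity)]
      exact Real.rpow_le_rpow he.le hεe.le hs.le
    have h3 : 0 ≤ w ^ (-(1 / r)) * ε ^ s * g := by positivity
    have h4 : 0 ≤ w ^ (-(1 / rs)) * ε ^ (-((N : ℝ) / rs)) * F := by positivity
    nlinarith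

lemma sobolev_bdd {N : ℕ} (hN : 0 < N) {s r e rs : ℝ} (hs : 0 < s) (hr : 1 < r) (hsr : s * r < N)
    (hrs : rs = (N : ℝ) * r / ((N : ℝ) - s * r)) (he : 0 < e) :
    ∃ C : ℝ≥0∞, C ≠ ⊤ ∧ C ≠ 0 ∧ ∀ f : Euc N → ℝ, Measurable f →
      ∫⁻ y, ENNReal.ofReal (|f y| ^ rs) ≠ ⊤ →
      ∫⁻ y, ENNReal.ofReal (|f y| ^ rs) ≤ C * (∫⁻ x, Gf s r e f x) ^ (rs / r) := by
  have hd : 0 < (N : ℝ) - s * r := by linarith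
  have hN' : (0 : ℝ) < N := by exact_mod_cast hN
  have hrr : r < rs := by
    rw [hrs, lt_div_iff₀ hd]; have : 0 < s * r := by positivity
    nlinarith
  have hw0 : 0 < (volume (Metric.ball (0 : Euc N) 1)).toReal :=
    ENNReal.toReal_pos (Metric.measure_ball_pos _ _ one_pos).ne' measure_ball_lt_top.ne
  set w := (volume (Metric.ball (0 : Euc N) 1)).toReal with hw
  set A := w ^ (-(1 / r)) + e ^ (-s)
  set B := w ^ (-(1 / rs))
  have hA : 0 < A := by positivity
  have hB : 0 < B := by positivity
  refine ⟨ENNReal.ofReal (((A + B) ^ rs) ^ (rs / r)), ENNReal.ofReal_ne_top,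
    (ENNReal.ofReal_pos.2 (by positivity)).ne', fun f hf hfin => ?_⟩
  set Φ := ∫⁻ y, ENNReal.ofReal (|f y| ^ rs) with hΦ
  rcases eq_or_ne Φ 0 with h0 | h0
  · rw [h0]; exact zero_le
  set F := Φ.toReal ^ (1 / rs) with hF
  have hΦ0 : 0 < Φ.toReal := ENNReal.toReal_pos h0 hfin
  have hF0 : 0 < F := by positivity
  have hFr : F ^ rs = Φ.toReal := by
    rw [hF, ← Real.rpow_mul hΦ0.le, one_div_mul_cancel (by linarith), Real.rpow_one]
  have hFF : Φ = ENNReal.ofReal (F ^ rs) := by rw [hFr, ENNReal.ofReal_toReal hfin]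
  have pt : ∀ x, ENNReal.ofReal (|f x| ^ rs) ≤
      ENNReal.ofReal ((A + B) ^ rs * F ^ (rs - r)) * Gf s r e f x := by
    intro x
    rcases eq_or_ne (Gf s r e f x) ⊤ with hG | hG
    · rw [hG, ENNReal.mul_top (ENNReal.ofReal_pos.2 (by positivity)).ne']; exact le_top
    rcases eq_or_ne (Gf s r e f x) 0 with hG0 | hG0
    · have : ENNReal.ofReal (|f x| ^ r) = 0 := by
        have : ENNReal.ofReal (|f x| ^ r) ≤ 0 := by rw [← hG0, Gf]; exact le_self_add
        exact le_antisymm this zero_le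
      rw [ENNReal.ofReal_eq_zero] at this
      have h1 : |f x| ^ r = 0 := le_antisymm this (by positivity)
      rw [Real.rpow_eq_zero (abs_nonneg _) (by linarith)] at h1
      rw [h1, Real.zero_rpow (by linarith)]; simp
    set g := (Gf s r e f x).toReal ^ (1 / r) with hg
    have hg1 : 0 < (Gf s r e f x).toReal := ENNReal.toReal_pos hG0 hG
    have hg0 : 0 < g := by positivity
    have hgr : g ^ r = (Gf s r e f x).toReal := by
      rw [hg, ← Real.rpow_mul hg1.le, one_div_mul_cancel (by linarith), Real.rpow_one]
    have hGG : Gf s r e f x = ENNReal.ofReal (g ^ r) := by rw [hgr, ENNReal.ofReal_toReal hG]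
    have := real_opt hN' hs hr hsr hrs (abs_nonneg (f x)) hg0 hF0 hA.le hB.le
      (fun ε hε => ptwise hN hs hr (by linarith) he hf x hw hg0.le hF0.le hGG hFF hε)
    rw [hGG, ← ENNReal.ofReal_mul (by positivity)]
    apply ENNReal.ofReal_le_ofReal
    calc _ ≤ _ := this
      _ = _ := by ring
  have h1 : Φ ≤ ENNReal.ofReal ((A + B) ^ rs * F ^ (rs - r)) * ∫⁻ x, Gf s r e f x := by
    rw [← lintegral_const_mul' _ _ ENNReal.ofReal_ne_top]
    exact lintegral_mono pt
  rcases eq_or_ne (∫⁻ x, Gf s r e f x) ⊤ with hG | hG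
  · rw [hG, ENNReal.top_rpow_of_pos (by apply div_pos <;> linarith), ENNReal.mul_top (ENNReal.ofReal_pos.2 (by positivity)).ne']; exact le_top
  set J := (∫⁻ x, Gf s r e f x).toReal with hJ
  have hJJ : ∫⁻ x, Gf s r e f x = ENNReal.ofReal J := (ENNReal.ofReal_toReal hG).symm
  have hJ0 : 0 ≤ J := ENNReal.toReal_nonneg
  rw [hJJ, ENNReal.ofReal_rpow_of_nonneg hJ0 (by apply div_nonneg <;> linarith), ← ENNReal.ofReal_mul (by positivity), hFF]
  apply ENNReal.ofReal_le_ofReal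
  rw [hJJ, hFF, ← ENNReal.ofReal_mul (by positivity), ENNReal.ofReal_le_ofReal_iff (by positivity)] at h1
  have h2 : F ^ r ≤ (A + B) ^ rs * J := by
    have e1 : F ^ rs = F ^ (rs - r) * F ^ r := by rw [← Real.rpow_add hF0]; congr 1; ring
    rw [e1] at h1
    have : 0 < F ^ (rs - r) := by positivity
    refine le_of_mul_le_mul_left ?_ this
    linarith
  calc F ^ rs = (F ^ r) ^ (rs / r) := by rw [← Real.rpow_mul hF0.le]; congr 1; field_simp
    _ ≤ ((A + B) ^ rs * J) ^ (rs / r) := Real.rpow_le_rpow (by positivity) h2 (by apply div_nonneg <;> linarith)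
    _ = _ := Real.mul_rpow (by positivity) hJ0

def trunc (M t : ℝ) : ℝ := max (-M) (min t M)

lemma trunc_diff {M : ℝ} (a b : ℝ) : |trunc M a - trunc M b| ≤ |a - b| := by
  unfold trunc
  refine (abs_max_sub_max_le_max _ _ _ _).trans ?_
  simp only [sub_self, abs_zero]
  refine max_le (abs_nonneg _) ((abs_min_sub_min_le_max _ _ _ _).trans ?_)
  simp

lemma trunc_abs {M : ℝ} (hM : 0 ≤ M) (a : ℝ) : |trunc M a| ≤ |a| := by
  have := trunc_diff (M := M) a 0
  simpa [trunc, hM] using this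

lemma trunc_abs' {M : ℝ} (hM : 0 ≤ M) (a : ℝ) : |trunc M a| ≤ M := by
  unfold trunc
  rw [abs_le]; exact ⟨le_max_left _ _, max_le (by linarith) (min_le_right _ _)⟩

lemma sobolev_ineq {N : ℕ} (hN : 0 < N) {s r e rs : ℝ} (hs : 0 < s) (hr : 1 < r) (hsr : s * r < N)
    (hrs : rs = (N : ℝ) * r / ((N : ℝ) - s * r)) (he : 0 < e) :
    ∃ C : ℝ≥0∞, C ≠ ⊤ ∧ C ≠ 0 ∧ ∀ f : Euc N → ℝ, Measurable f →
      ∫⁻ y, ENNReal.ofReal (|f y| ^ rs) ≤ C * (∫⁻ x, Gf s r e f x) ^ (rs / r) := by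
  obtain ⟨C, hC, hC0, h⟩ := sobolev_bdd hN hs hr hsr hrs he
  refine ⟨C, hC, hC0, fun f hf => ?_⟩
  have hd : 0 < (N : ℝ) - s * r := by linarith
  have hrr : r < rs := by
    rw [hrs, lt_div_iff₀ hd]; have : 0 < s * r := by positivity
    nlinarith
  have hrr' : 0 < rs / r := by apply div_pos <;> linarith
  rcases eq_or_ne (∫⁻ x, Gf s r e f x) ⊤ with hG | hG
  · rw [hG, ENNReal.top_rpow_of_pos hrr', ENNReal.mul_top hC0]; exact le_top
  have hfr : ∫⁻ x, ENNReal.ofReal (|f x| ^ r) ≠ ⊤ :=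
    ne_top_of_le_ne_top hG (lintegral_mono fun x => by rw [Gf]; exact le_self_add)
  have hm : ∀ M : ℝ, Measurable (fun x => trunc M (f x)) := fun M => by unfold trunc; fun_prop
  have key : ∀ n : ℕ, ∫⁻ y, ENNReal.ofReal (|trunc n (f y)| ^ rs) ≤ C * (∫⁻ x, Gf s r e f x) ^ (rs / r) := by
    intro n
    refine (h _ (hm n) ?_).trans ?_
    · refine ne_top_of_le_ne_top (ENNReal.mul_ne_top (a := ENNReal.ofReal ((n : ℝ) ^ (rs - r))) ENNReal.ofReal_ne_top hfr) ?_
      rw [← lintegral_const_mul' _ _ ENNReal.ofReal_ne_top]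
      refine lintegral_mono fun y => ?_
      rw [← ENNReal.ofReal_mul (by positivity)]
      apply ENNReal.ofReal_le_ofReal
      calc |trunc n (f y)| ^ rs = |trunc n (f y)| ^ (rs - r) * |trunc n (f y)| ^ r := by
            rcases (abs_nonneg (trunc n (f y))).eq_or_lt with h0 | h0
            · rw [← h0, Real.zero_rpow (by linarith), Real.zero_rpow (by linarith : r ≠ 0), mul_zero]
            · rw [← Real.rpow_add h0]; congr 1; ring
        _ ≤ _ := by
            exact mul_le_mul
              (Real.rpow_le_rpow (abs_nonneg _) (trunc_abs' (by positivity) _) (by linarith))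
              (Real.rpow_le_rpow (abs_nonneg _) (trunc_abs (by positivity) _) (by linarith))
              (by positivity) (by positivity)
    · gcongr with x
      unfold Gf nk
      refine add_le_add (ENNReal.ofReal_le_ofReal (Real.rpow_le_rpow (abs_nonneg _) (trunc_abs (by positivity) _) (by linarith)))
        (lintegral_mono fun y => ?_)
      dsimp only
      split_ifs
      · exact ENNReal.ofReal_le_ofReal (div_le_div_of_nonneg_right
          (Real.rpow_le_rpow (abs_nonneg _) (trunc_diff _ _) (by linarith)) (by positivity))
      · exact le_rfl
  calc ∫⁻ y, ENNReal.ofReal (|f y| ^ rs)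
      ≤ ∫⁻ y, liminf (fun n : ℕ => ENNReal.ofReal (|trunc n (f y)| ^ rs)) atTop := by
        refine lintegral_mono fun y => ?_
        have : Tendsto (fun n : ℕ => ENNReal.ofReal (|trunc n (f y)| ^ rs)) atTop (𝓝 (ENNReal.ofReal (|f y| ^ rs))) := by
          apply tendsto_const_nhds.congr'
          obtain ⟨m, hm⟩ := exists_nat_ge |f y|
          filter_upwards [eventually_ge_atTop m] with n hn
          have h1 : |f y| ≤ n := hm.trans (by exact_mod_cast hn)
          rw [abs_le] at h1
          rw [trunc, min_eq_left h1.2, max_eq_right h1.1]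
        rw [this.liminf_eq]
    _ ≤ liminf (fun n : ℕ => ∫⁻ y, ENNReal.ofReal (|trunc n (f y)| ^ rs)) atTop :=
        lintegral_liminf_le fun n => by have := hm n; fun_prop
    _ ≤ _ := by
        refine Filter.liminf_le_of_frequently_le' ?_
        exact Frequently.of_forall key

lemma abs_add_rpow {η q Q : ℝ} (hη : 0 < η) (hq : 1 ≤ q) (hQ : q ≤ Q) (a b : ℝ) :
    |a + b| ^ q ≤ (1 + η) ^ Q * |a| ^ q + (1 + 1 / η) ^ Q * |b| ^ q := by
  have h1 := (convexOn_rpow hq).2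
    (show (1 + η) * |a| ∈ Ici (0:ℝ) from mem_Ici.2 (by positivity))
    (show (1 + 1 / η) * |b| ∈ Ici (0:ℝ) from mem_Ici.2 (by positivity))
    (show 0 ≤ 1 / (1 + η) by positivity) (show 0 ≤ η / (1 + η) by positivity) (by field_simp)
  have h2 : (1 / (1 + η)) • ((1 + η) * |a|) + (η / (1 + η)) • ((1 + 1 / η) * |b|) = |a| + |b| := by
    simp only [smul_eq_mul]; field_simp; ring
  rw [h2] at h1
  dsimp only at h1
  rw [Real.mul_rpow (by positivity) (by positivity), Real.mul_rpow (by positivity) (by positivity)] at h1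
  simp only [smul_eq_mul] at h1
  have e1 : 1 / (1 + η) ≤ 1 := by rw [div_le_one (by positivity)]; linarith
  have e2 : η / (1 + η) ≤ 1 := by rw [div_le_one (by positivity)]; linarith
  have e3 : (1 + η) ^ q ≤ (1 + η) ^ Q := Real.rpow_le_rpow_of_exponent_le (by linarith) hQ
  have e4 : (1 + 1 / η) ^ q ≤ (1 + 1 / η) ^ Q :=
    Real.rpow_le_rpow_of_exponent_le (by have : 0 < 1 / η := by positivity
                                         linarith) hQ
  calc |a + b| ^ q ≤ (|a| + |b|) ^ q := Real.rpow_le_rpow (abs_nonneg _) (abs_add_le _ _) (by linarith)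
    _ ≤ _ := h1
    _ ≤ 1 * ((1 + η) ^ Q * |a| ^ q) + 1 * ((1 + 1 / η) ^ Q * |b| ^ q) := by gcongr
    _ = _ := by ring

lemma local_compact {N : ℕ} (hN : 0 < N) {s r e : ℝ} (hs : 0 < s) (hr : 1 < r) (he : 0 < e)
    (v : ℕ → Euc N → ℝ) (hm : ∀ n, Measurable (v n)) {M : ℝ≥0∞} (hMt : M ≠ ⊤)
    (hM : ∀ n, ∫⁻ x, Gf s r e (v n) x ≤ M)
    (hw : ∀ (x : Euc N) (ε : ℝ), 0 < ε → Tendsto (fun n => ∫ y in Metric.ball x ε, v n y) atTop (𝓝 0))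
    (w : Euc N → ℝ≥0∞) (hwm : Measurable w) (hw1 : ∀ x, w x ≤ 1) (hwi : ∫⁻ x, w x ≠ ⊤) :
    Tendsto (fun n => ∫⁻ x, w x * ENNReal.ofReal (|v n x| ^ r)) atTop (𝓝 0) := by
  have hω : 0 < (volume (Metric.ball (0 : Euc N) 1)).toReal :=
    ENNReal.toReal_pos (Metric.measure_ball_pos _ _ one_pos).ne' measure_ball_lt_top.ne
  set ω := (volume (Metric.ball (0 : Euc N) 1)).toReal with hωd
  have hvr : ∀ n, ∫⁻ x, ENNReal.ofReal (|v n x| ^ r) ≤ M := fun n =>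
    (lintegral_mono fun x => by rw [Gf]; exact le_self_add).trans (hM n)
  have main : ∀ ε, 0 < ε → ε ≤ e → ∃ J : ℕ → ℝ≥0∞, Tendsto J atTop (𝓝 0) ∧ ∀ n,
      ∫⁻ x, w x * ENNReal.ofReal (|v n x| ^ r) ≤
        ENNReal.ofReal (2 ^ r * (ε ^ (s * r) / ω)) * M + ENNReal.ofReal (2 ^ r) * J n := by
    intro ε hε hεe
    obtain ⟨b, hb⟩ : ∃ b, b = ε ^ (N : ℝ) * ω := ⟨_, rfl⟩
    have hb0 : 0 < b := by rw [hb]; positivity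
    have hvol : ∀ x : Euc N, volume (Metric.ball x ε) = ENNReal.ofReal b := fun x => by
      rw [vol_ball hN x hε, hb, hωd]
    have hbd : ∀ n x, ∫⁻ y in Metric.ball x ε, ‖v n y‖ₑ ≤ M ^ (1 / r) * ENNReal.ofReal b ^ (1 - 1 / r) := by
      intro n x
      refine (holder_one _ hr (hm n).enorm.aemeasurable).trans ?_
      rw [Measure.restrict_apply_univ, hvol]
      gcongr
      refine (setLIntegral_le_lintegral _ _).trans (le_trans (le_of_eq ?_) (hvr n))
      refine lintegral_congr fun y => ?_
      rw [ofReal_rpow' _ _ (by linarith), Real.enorm_eq_ofReal_abs]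
    have hKt : M ^ (1 / r) * ENNReal.ofReal b ^ (1 - 1 / r) ≠ ⊤ :=
      ENNReal.mul_ne_top (ENNReal.rpow_ne_top_of_nonneg (by positivity) hMt)
        (ENNReal.rpow_ne_top_of_nonneg (by rw [sub_nonneg, div_le_one (by linarith)]; linarith) ENNReal.ofReal_ne_top)
    have hint : ∀ n x, IntegrableOn (v n) (Metric.ball x ε) volume := fun n x =>
      ⟨(hm n).aestronglyMeasurable, (hbd n x).trans_lt hKt.lt_top⟩
    have hci : ∀ (x : Euc N) (c : ℝ), Integrable (fun _ : Euc N => c) (volume.restrict (Metric.ball x ε)) :=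
      fun x c => integrableOn_const (μ := volume) (s := Metric.ball x ε) (by simp [hvol]) (by simp)
    set A : ℕ → Euc N → ℝ := fun n x => b⁻¹ * ∫ y in Metric.ball x ε, v n y with hA
    have hAm : ∀ n, Measurable (A n) := by
      intro n
      have h1 : ∀ x : Euc N, ∫ y in Metric.ball x ε, v n y =
          ∫ y, (if dist y x < ε then v n y else 0) := by
        intro x
        rw [← integral_indicator measurableSet_ball]
        rfl
      have h2 : StronglyMeasurable (fun x : Euc N => ∫ y, (if dist y x < ε then v n y else 0)) := by
        refine StronglyMeasurable.integral_prod_right (f := fun (x y : Euc N) => (if dist y x < ε then v n y else 0)) ?_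
        refine Measurable.stronglyMeasurable ?_
        refine Measurable.ite (measurableSet_lt (by fun_prop) measurable_const) ?_ measurable_const
        exact (hm n).comp measurable_snd
      simp only [hA, h1]
      exact h2.measurable.const_mul _
    have hAb : ∀ n x, ENNReal.ofReal (|A n x| ^ r) ≤
        (ENNReal.ofReal b⁻¹ * (M ^ (1 / r) * ENNReal.ofReal b ^ (1 - 1 / r))) ^ r := by
      intro n x
      rw [ofReal_rpow' _ _ (by linarith)]
      refine ENNReal.rpow_le_rpow ?_ (by linarith)
      rw [hA]; simp only [abs_mul]
      rw [ENNReal.ofReal_mul (by positivity), abs_of_pos (by positivity)]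
      gcongr
      rw [← Real.enorm_eq_ofReal_abs]
      exact (enorm_integral_le_lintegral_enorm _).trans (hbd n x)
    refine ⟨fun n => ∫⁻ x, w x * ENNReal.ofReal (|A n x| ^ r), ?_, ?_⟩
    · have := tendsto_lintegral_of_dominated_convergence (μ := (volume : Measure (Euc N)))
        (F := fun n x => w x * ENNReal.ofReal (|A n x| ^ r)) (f := fun _ => 0)
        (fun x => w x * (ENNReal.ofReal b⁻¹ * (M ^ (1 / r) * ENNReal.ofReal b ^ (1 - 1 / r))) ^ r)
        (fun n => by have := hAm n; fun_prop) (fun n => Eventually.of_forall fun x => mul_le_mul' le_rfl (hAb n x))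
        (by
          rw [lintegral_mul_const _ hwm]
          exact ENNReal.mul_ne_top hwi (ENNReal.rpow_ne_top_of_nonneg (by linarith)
            (ENNReal.mul_ne_top ENNReal.ofReal_ne_top hKt)))
        (Eventually.of_forall fun x => by
          have h1 : Tendsto (fun n => A n x) atTop (𝓝 0) := by
            simpa using (hw x ε hε).const_mul b⁻¹
          have h2 : Tendsto (fun n => ENNReal.ofReal (|A n x| ^ r)) atTop (𝓝 (ENNReal.ofReal (|(0:ℝ)| ^ r))) :=
            ENNReal.tendsto_ofReal (h1.abs.rpow_const (Or.inr (by linarith)))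
          rw [abs_zero, Real.zero_rpow (by linarith), ENNReal.ofReal_zero] at h2
          simpa using ENNReal.Tendsto.const_mul h2 (Or.inr (ne_top_of_le_ne_top ENNReal.one_ne_top (hw1 x))))
      simpa using this
    · intro n
      have hdiff : ∀ x, ENNReal.ofReal (|v n x - A n x| ^ r) ≤ ENNReal.ofReal (ε ^ (s * r) / ω) * Gf s r e (v n) x := by
        intro x
        have k1 : ENNReal.ofReal (b * |v n x - A n x|) ≤ ∫⁻ y in Metric.ball x ε, ENNReal.ofReal |v n x - v n y| := by
          have : b * (v n x - A n x) = ∫ y in Metric.ball x ε, (v n x - v n y) := by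
            rw [integral_sub (hci x (v n x)) (hint n x), setIntegral_const, Measure.real, hvol,
              ENNReal.toReal_ofReal hb0.le, hA]
            simp only [smul_eq_mul]
            field_simp
          rw [← abs_of_pos hb0, ← abs_mul, this, ← Real.enorm_eq_ofReal_abs]
          refine (enorm_integral_le_lintegral_enorm _).trans (le_of_eq ?_)
          simp_rw [Real.enorm_eq_ofReal_abs]
        have k2 : ∫⁻ y in Metric.ball x ε, ENNReal.ofReal |v n x - v n y| ≤
            (ENNReal.ofReal (ε ^ ((N : ℝ) + s * r)) * Gf s r e (v n) x) ^ (1 / r) * ENNReal.ofReal b ^ (1 - 1 / r) := by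
          refine (holder_one _ hr (by have := hm n; fun_prop)).trans ?_
          rw [Measure.restrict_apply_univ, hvol]
          gcongr
          simp_rw [← ofReal_rpow' _ _ (by linarith : 0 ≤ r)]
          refine (ball_diff_bound hs hr hε hεe (v n) x).trans ?_
          gcongr
          rw [Gf]; exact le_add_self
        have k3 := ENNReal.rpow_le_rpow (k1.trans k2) (by linarith : 0 ≤ r)
        rw [ENNReal.mul_rpow_of_nonneg _ _ (by linarith), ← ENNReal.rpow_mul, ← ENNReal.rpow_mul,
          one_div_mul_cancel (by linarith), ENNReal.rpow_one, ENNReal.ofReal_rpow_of_nonneg (by positivity) (by linarith),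
          ENNReal.ofReal_rpow_of_pos hb0, mul_right_comm, ← ENNReal.ofReal_mul (by positivity)] at k3
        have e1 : ENNReal.ofReal (|v n x - A n x| ^ r) = ENNReal.ofReal (b ^ (-r)) * ENNReal.ofReal ((b * |v n x - A n x|) ^ r) := by
          rw [← ENNReal.ofReal_mul (by positivity), Real.mul_rpow hb0.le (abs_nonneg _), Real.rpow_neg hb0.le]
          congr 1
          field_simp
        rw [e1]
        refine (mul_le_mul' le_rfl k3).trans (le_of_eq ?_)
        rw [← mul_assoc, ← ENNReal.ofReal_mul (by positivity)]
        congr 2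
        rw [show (1 - 1 / r) * r = r - 1 by field_simp, Real.rpow_sub hb0, Real.rpow_neg hb0.le, Real.rpow_one,
          Real.rpow_add hε]
        field_simp
        exact hb.symm
      have hpt : ∀ x, w x * ENNReal.ofReal (|v n x| ^ r) ≤
          ENNReal.ofReal (2 ^ r * (ε ^ (s * r) / ω)) * Gf s r e (v n) x +
          ENNReal.ofReal (2 ^ r) * (w x * ENNReal.ofReal (|A n x| ^ r)) := by
        intro x
        have h1 : |v n x| ^ r ≤ 2 ^ r * |v n x - A n x| ^ r + 2 ^ r * |A n x| ^ r := by
          have := abs_add_rpow one_pos hr.le le_rfl (v n x - A n x) (A n x)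
          norm_num at this
          simpa using this
        calc w x * ENNReal.ofReal (|v n x| ^ r) ≤ w x * ENNReal.ofReal (2 ^ r * |v n x - A n x| ^ r + 2 ^ r * |A n x| ^ r) := by
              gcongr
          _ = w x * (ENNReal.ofReal (2 ^ r) * ENNReal.ofReal (|v n x - A n x| ^ r)) + ENNReal.ofReal (2 ^ r) * (w x * ENNReal.ofReal (|A n x| ^ r)) := by
              rw [ENNReal.ofReal_add (by positivity) (by positivity), ENNReal.ofReal_mul (by positivity),
                ENNReal.ofReal_mul (by positivity)]; ring
          _ ≤ 1 * (ENNReal.ofReal (2 ^ r) * (ENNReal.ofReal (ε ^ (s * r) / ω) * Gf s r e (v n) x)) + ENNReal.ofReal (2 ^ r) * (w x * ENNReal.ofReal (|A n x| ^ r)) := by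
              gcongr
              · exact hw1 x
              · exact hdiff x
          _ = _ := by rw [one_mul, ← mul_assoc, ← ENNReal.ofReal_mul (by positivity)]
      refine (lintegral_mono hpt).trans ?_
      rw [lintegral_add_left ((measurable_Gf s r e (hm n)).const_mul _), lintegral_const_mul' _ _ ENNReal.ofReal_ne_top,
        lintegral_const_mul' _ _ ENNReal.ofReal_ne_top]
      gcongr
      exact hM n
  rw [ENNReal.tendsto_nhds_zero]
  intro η hη
  have t1 : Tendsto (fun ε : ℝ => ENNReal.ofReal (2 ^ r * (ε ^ (s * r) / ω)) * M) (𝓝 0) (𝓝 0) := by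
    have : Tendsto (fun ε : ℝ => 2 ^ r * (ε ^ (s * r) / ω)) (𝓝 0) (𝓝 (2 ^ r * ((0:ℝ) ^ (s * r) / ω))) :=
      ((Real.continuousAt_rpow_const 0 (s * r) (Or.inr (by positivity))).tendsto.div_const ω).const_mul _
    rw [Real.zero_rpow (by positivity), zero_div, mul_zero] at this
    have := ENNReal.Tendsto.mul_const (b := M) (ENNReal.tendsto_ofReal this) (Or.inr hMt)
    simpa using this
  rw [ENNReal.tendsto_nhds_zero] at t1
  have hη2 : 0 < η / 2 := by simpa using hη.ne'
  have t2 := (t1 (η / 2) hη2).filter_mono (nhdsWithin_le_nhds (s := Ioi 0))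
  obtain ⟨ε, hε1, hε0, hε2⟩ := (t2.and ((Ioo_mem_nhdsGT he))).exists
  obtain ⟨J, hJ, hJn⟩ := main ε hε0 hε2.le
  have hJ2 : Tendsto (fun n => ENNReal.ofReal (2 ^ r) * J n) atTop (𝓝 0) := by
    simpa using ENNReal.Tendsto.const_mul hJ (Or.inr ENNReal.ofReal_ne_top)
  rw [ENNReal.tendsto_nhds_zero] at hJ2
  filter_upwards [hJ2 (η / 2) hη2] with n hn
  calc _ ≤ _ := hJn n
    _ ≤ η / 2 + η / 2 := add_le_add hε1 hn
    _ = η := ENNReal.add_halves η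

structure IsTest {N : ℕ} (φ : Euc N → ℝ) : Prop where
  lip : ∃ L : ℝ≥0, LipschitzWith L φ
  nonneg : ∀ x, 0 ≤ φ x
  le_one : ∀ x, φ x ≤ 1
  supp : ∃ R : ℝ, 0 < R ∧ ∀ x, φ x ≠ 0 → x ∈ Metric.ball (0 : Euc N) R

lemma IsTest.cont {N : ℕ} {φ : Euc N → ℝ} (h : IsTest φ) : Continuous φ := by
  obtain ⟨L, hL⟩ := h.lip; exact hL.continuous

lemma exists_test {N : ℕ} {K : Set (Euc N)} (hK : IsCompact K) {δ : ℝ} (hδ : 0 < δ) :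
    ∃ φ : Euc N → ℝ, IsTest φ ∧ (∀ x ∈ K, φ x = 1) ∧ ∀ x, φ x ≠ 0 → x ∈ Metric.cthickening δ K := by
  have hsub : ∀ x, (thickenedIndicator hδ K x : ℝ) ≠ 0 → x ∈ Metric.cthickening δ K := by
    intro x hx
    by_contra h
    apply hx
    rw [thickenedIndicator_zero hδ K (fun h' => h (Metric.thickening_subset_cthickening _ _ h'))]
    simp
  refine ⟨fun x => (thickenedIndicator hδ K x : ℝ), ⟨⟨δ.toNNReal⁻¹, ?_⟩, fun x => NNReal.coe_nonneg _, fun x => ?_, ?_⟩, ?_, hsub⟩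
  · have := lipschitzWith_thickenedIndicator hδ K
    exact fun x y => this x y
  · exact_mod_cast thickenedIndicator_le_one hδ K x
  · have hb : Bornology.IsBounded (Metric.cthickening δ K) := hK.isBounded.cthickening
    obtain ⟨R, hR0, hR⟩ := hb.subset_ball_lt 0 0
    exact ⟨R, hR0, fun x hx => hR (hsub x hx)⟩
  · intro x hx
    simp [thickenedIndicator_one hδ K hx]

lemma le_of_compact {N : ℕ} {ρ σ : Measure (Euc N)} [IsFiniteMeasure σ]
    (h : ∀ K, IsCompact K → ρ K ≤ σ K) : ρ ≤ σ := by
  have hfin : IsFiniteMeasure ρ := by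
    constructor
    have h1 : Tendsto (fun n : ℕ => ρ (Metric.closedBall 0 n)) atTop (𝓝 (ρ (⋃ n : ℕ, Metric.closedBall 0 n))) :=
      tendsto_measure_iUnion_atTop fun a b hab => Metric.closedBall_subset_closedBall (by exact_mod_cast hab)
    rw [Metric.iUnion_closedBall_nat] at h1
    refine (le_of_tendsto h1 (Eventually.of_forall fun n => ?_)).trans_lt (measure_lt_top σ univ)
    exact (h _ (isCompact_closedBall _ _)).trans (measure_mono (subset_univ _))
  rw [Measure.le_iff]
  intro s hs
  rw [hs.measure_eq_iSup_isCompact]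
  exact iSup₂_le fun K hK => iSup_le fun hKc => (h K hKc).trans (measure_mono hK)

lemma holder_sets {N : ℕ} {ρ σ : Measure (Euc N)} [IsFiniteMeasure σ] [IsFiniteMeasure ρ]
    {C : ℝ≥0∞} {κ : ℝ} (hκ : 0 < κ)
    (h : ∀ K, IsCompact K → ρ K ≤ C * σ K ^ κ) (E : Set (Euc N)) (hE : MeasurableSet E) :
    ρ E ≤ C * σ E ^ κ := by
  rw [hE.measure_eq_iSup_isCompact]
  refine iSup₂_le fun K hK => iSup_le fun hKc => (h K hKc).trans ?_
  gcongr

lemma atoms_countable {N : ℕ} (σ : Measure (Euc N)) [IsFiniteMeasure σ] : {x | σ {x} ≠ 0}.Countable := by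
  have := Measure.countable_meas_pos_of_disjoint_iUnion (μ := σ) (As := fun x : Euc N => {x})
    (fun x => measurableSet_singleton x) (fun x y hxy => by simpa using hxy)
  simpa [pos_iff_ne_zero] using this

lemma atomic {N : ℕ} {ρ σ : Measure (Euc N)} [IsFiniteMeasure σ] [IsFiniteMeasure ρ]
    {C : ℝ≥0∞} (hC : C ≠ ⊤) {κ : ℝ} (hκ : 1 < κ)
    (h : ∀ K, IsCompact K → ρ K ≤ C * σ K ^ κ) : ρ {x | σ {x} = 0} = 0 := by
  set E := {x | σ {x} = 0} with hEd
  have hE : MeasurableSet E := by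
    have := (atoms_countable σ).measurableSet.compl
    convert this using 1
    ext x; simp [hEd]
  have hset := holder_sets (by linarith) h
  have key : ∀ ε : ℝ≥0∞, 0 < ε → ρ E ≤ C * ε ^ (κ - 1) * σ E := by
    intro ε hε
    have hb : ∀ x : Euc N, ∃ δ : ℝ, 0 < δ ∧ (x ∈ E → σ (Metric.ball x δ) ≤ ε) := by
      intro x
      by_cases hx : x ∈ E
      · have ht := tendsto_measure_cthickening_of_isCompact (μ := σ) (isCompact_singleton (x := x))
        rw [show σ {x} = 0 from hx, ENNReal.tendsto_nhds_zero] at ht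
        have := (ht ε hε).filter_mono (nhdsWithin_le_nhds (s := Ioi 0))
        obtain ⟨δ, h1, h2⟩ := (this.and self_mem_nhdsWithin).exists
        refine ⟨δ, h2, fun _ => (measure_mono ?_).trans h1⟩
        rw [Metric.cthickening_singleton _ (le_of_lt h2)]
        exact Metric.ball_subset_closedBall
      · exact ⟨1, one_pos, fun h => absurd h hx⟩
    choose δ hδ hδ2 using hb
    obtain ⟨T, hTE, hTc, hTcov⟩ := TopologicalSpace.countable_cover_nhdsWithin (s := E) (f := fun x => Metric.ball x (δ x))
      (fun x hx => mem_nhdsWithin_of_mem_nhds (Metric.ball_mem_nhds x (hδ x)))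
    rcases T.eq_empty_or_nonempty with hT | hT
    · rw [hT] at hTcov
      simp at hTcov
      simp [hTcov]
    obtain ⟨g, hg⟩ := hTc.exists_eq_range hT
    set P : ℕ → Set (Euc N) := fun n => E ∩ Metric.ball (g n) (δ (g n))
    have hPm : ∀ n, MeasurableSet (P n) := fun n => hE.inter measurableSet_ball
    have hPU : E = ⋃ n, disjointed P n := by
      rw [iUnion_disjointed]
      ext x
      simp only [P, mem_iUnion, mem_inter_iff, exists_and_left]
      refine ⟨fun hx => ⟨hx, ?_⟩, fun hx => hx.1⟩
      have := hTcov hx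
      rw [hg] at this
      simpa using this
    have hDm : ∀ n, MeasurableSet (disjointed P n) := fun n => MeasurableSet.disjointed hPm n
    have hDs : ∀ n, σ (disjointed P n) ≤ ε := fun n =>
      (measure_mono ((disjointed_subset P n).trans inter_subset_right)).trans
        (hδ2 _ (hTE (hg ▸ mem_range_self n)))
    calc ρ E = ∑' n, ρ (disjointed P n) := by
          conv_lhs => rw [hPU]
          exact measure_iUnion (disjoint_disjointed P) hDm
      _ ≤ ∑' n, C * ε ^ (κ - 1) * σ (disjointed P n) := by
          refine ENNReal.tsum_le_tsum fun n => (hset _ (hDm n)).trans ?_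
          have : σ (disjointed P n) ^ κ = σ (disjointed P n) ^ (κ - 1) * σ (disjointed P n) := by
            have h1 := ENNReal.rpow_add_of_nonneg (x := σ (disjointed P n)) (κ - 1) 1 (by linarith) zero_le_one
            rw [ENNReal.rpow_one, sub_add_cancel] at h1
            exact h1
          rw [this, mul_assoc]
          exact mul_le_mul' le_rfl (mul_le_mul' (ENNReal.rpow_le_rpow (hDs n) (by linarith)) le_rfl)
      _ = C * ε ^ (κ - 1) * σ E := by
          rw [ENNReal.tsum_mul_left]
          conv_rhs => rw [hPU]
          rw [measure_iUnion (disjoint_disjointed P) hDm]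
  have ht : Tendsto (fun ε : ℝ≥0∞ => C * ε ^ (κ - 1) * σ E) (𝓝[>] 0) (𝓝 0) := by
    have h1 : Tendsto (fun ε : ℝ≥0∞ => ε ^ (κ - 1)) (𝓝[>] 0) (𝓝 (0 ^ (κ - 1))) :=
      (ENNReal.continuous_rpow_const.tendsto 0).mono_left nhdsWithin_le_nhds
    rw [ENNReal.zero_rpow_of_pos (by linarith)] at h1
    have h2 := ENNReal.Tendsto.mul_const (b := σ E) (ENNReal.Tendsto.const_mul h1 (Or.inr hC)) (Or.inr (measure_ne_top σ E))
    simpa using h2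
  refine le_antisymm (ge_of_tendsto ht ?_) zero_le
  filter_upwards [self_mem_nhdsWithin] with ε hε using key ε hε

def kz {N : ℕ} (e a : ℝ) (z : Euc N) : ℝ≥0∞ :=
  if ‖z‖ < e then ENNReal.ofReal (‖z‖ ^ (a - (N : ℝ))) else 0

lemma measurable_kz {N : ℕ} (e a : ℝ) : Measurable (kz (N := N) e a) := by
  unfold kz
  refine Measurable.ite ?_ ?_ measurable_const
  · exact measurableSet_lt measurable_norm measurable_const
  · exact ENNReal.measurable_ofReal.comp (measurable_norm.pow_const _)

lemma measurable_nk_right {N : ℕ} (s r e : ℝ) {f : Euc N → ℝ} (hf : Measurable f) (x : Euc N) :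
    Measurable (nk s r e f x) := by
  have h : Measurable (fun y : Euc N => (x, y)) := measurable_prodMk_left
  have h2 := (measurable_nk s r e hf).comp h
  exact h2

lemma kz_fin {N : ℕ} (hN : 0 < N) {e a : ℝ} (ha : 0 < a) : ∫⁻ z : Euc N, kz e a z < ⊤ := by
  have h1 : IntegrableOn (fun z : Euc N => ‖z‖ ^ (a - (N:ℝ))) (Metric.ball 0 e) := by
    have : Nontrivial (Euc N) := by
      have : Nonempty (Fin N) := ⟨⟨0, hN⟩⟩
      infer_instance
    rw [integrableOn_fun_norm_addHaar (μ := (volume : Measure (Euc N))) (f := fun t => t ^ (a - (N:ℝ)))]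
    by_cases he : 0 < e
    · refine ((intervalIntegral.integrableOn_Ioo_rpow_iff (s := a - 1) he).2 (by linarith)).congr_fun ?_ measurableSet_Ioo
      intro t ht
      simp only [finrank_euclideanSpace, Fintype.card_fin, smul_eq_mul]
      rw [← Real.rpow_natCast, ← Real.rpow_add ht.1]
      congr 1
      rw [Nat.cast_sub (by omega)]; push_cast; ring
    · rw [Ioo_eq_empty he]; exact integrableOn_empty
  have h2 := h1.2
  refine lt_of_le_of_lt ?_ h2
  rw [← lintegral_indicator measurableSet_ball]
  refine lintegral_mono fun z => ?_
  unfold kz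
  by_cases hz : ‖z‖ < e
  · rw [if_pos hz, indicator_of_mem (by simpa using hz)]
    rw [← Real.norm_of_nonneg (Real.rpow_nonneg (norm_nonneg z) _), ofReal_norm]
  · rw [if_neg hz]; exact zero_le

def kf {N : ℕ} (a : ℝ) (z : Euc N) : ℝ≥0∞ := ENNReal.ofReal ((1 + ‖z‖) ^ (-((N : ℝ) + a)))

lemma measurable_kf {N : ℕ} (a : ℝ) : Measurable (kf (N := N) a) := by
  unfold kf
  exact ENNReal.measurable_ofReal.comp ((measurable_const.add measurable_norm).pow_const _)

lemma kf_fin {N : ℕ} {a : ℝ} (ha : 0 < a) : ∫⁻ z : Euc N, kf a z < ⊤ := by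
  have h := (integrable_one_add_norm (E := Euc N) (μ := volume) (r := (N:ℝ) + a) (by simp [ha]))
  exact h.lintegral_lt_top

lemma lintegral_conv {N : ℕ} {k h : Euc N → ℝ≥0∞} (hk : Measurable k) (hh : Measurable h) :
    ∫⁻ x, ∫⁻ y, h y * k (x - y) = (∫⁻ z, k z) * ∫⁻ y, h y := by
  rw [lintegral_lintegral_swap (by fun_prop)]
  have : ∀ y, ∫⁻ x, h y * k (x - y) = h y * ∫⁻ z, k z := by
    intro y
    rw [lintegral_const_mul _ (by fun_prop)]
    rw [lintegral_sub_right_eq_self]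
  simp_rw [this]
  rw [lintegral_mul_const _ hh, mul_comm]

set_option maxHeartbeats 1000000 in
lemma near_energy {N : ℕ} (hN : 0 < N) {s r e : ℝ} (hs : 0 < s) (hs1 : s < 1) (hr : 1 < r) (he : 0 < e)
    {φ : Euc N → ℝ} (hφ : IsTest φ) : ∃ R : ℝ, 0 < R ∧ (∀ x, φ x ≠ 0 → x ∈ Metric.ball (0 : Euc N) R) ∧
    ∀ η : ℝ, 0 < η → ∃ C : ℝ≥0∞, C ≠ ⊤ ∧ ∀ v : Euc N → ℝ, Measurable v →
      ∫⁻ x, Gf s r e (fun y => φ y * v y) x ≤ ENNReal.ofReal ((1 + η) ^ r) * (∫⁻ x, ENNReal.ofReal (φ x ^ r) * Gf s r e v x)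
        + C * ∫⁻ y in Metric.ball (0 : Euc N) R, ENNReal.ofReal (|v y| ^ r) := by
  obtain ⟨L, hL⟩ := hφ.lip
  obtain ⟨R, hR, hsupp⟩ := hφ.supp
  have hφm : Measurable φ := hφ.cont.measurable
  refine ⟨R + e, by linarith, fun x hx => Metric.ball_subset_ball (by linarith) (hsupp x hx), ?_⟩
  intro η hη
  set a := r - s * r with ha
  have ha0 : 0 < a := by nlinarith
  refine ⟨ENNReal.ofReal ((1 + 1/η)^r * (L:ℝ)^r) * ∫⁻ z : Euc N, kz e a z,
    ENNReal.mul_ne_top ENNReal.ofReal_ne_top (kz_fin hN ha0).ne, ?_⟩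
  intro v hv
  set h : Euc N → ℝ≥0∞ := (Metric.ball (0 : Euc N) (R+e)).indicator fun y => ENNReal.ofReal (|v y| ^ r) with hh
  have hvm : Measurable fun y => ENNReal.ofReal (|v y| ^ r) := by fun_prop
  have hhm : Measurable h := hvm.indicator measurableSet_ball
  have hpt : ∀ x y, nk s r e (fun y => φ y * v y) x y ≤
      ENNReal.ofReal ((1 + η) ^ r) * (ENNReal.ofReal (φ x ^ r) * nk s r e v x y)
      + ENNReal.ofReal ((1 + 1/η)^r * (L:ℝ)^r) * (h y * kz e a (x - y)) := by
    intro x y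
    unfold nk kz
    have hd : ‖x - y‖ = dist x y := (dist_eq_norm x y).symm
    rw [hd]
    by_cases hxy : dist x y < e
    swap
    · simp [hxy]
    simp only [hxy, if_true]
    have hφr : 0 ≤ φ x := hφ.nonneg x
    have hη' : 0 < 1 + 1/η := by positivity
    by_cases hy : y ∈ Metric.ball (0 : Euc N) (R + e)
    · rw [hh, indicator_of_mem hy]
      rw [← ENNReal.ofReal_mul (by positivity), ← ENNReal.ofReal_mul (by positivity), ← ENNReal.ofReal_mul (by positivity),
        ← ENNReal.ofReal_mul (by positivity), ← ENNReal.ofReal_add (by positivity) (by positivity)]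
      apply ENNReal.ofReal_le_ofReal
      rcases (dist_nonneg (x := x) (y := y)).eq_or_lt with h0 | hd0
      · have : x = y := dist_eq_zero.1 h0.symm
        subst this
        have : (0:ℝ) ^ r = 0 := Real.zero_rpow (by linarith)
        simp [this]
        positivity
      have e1 : φ x * v x - φ y * v y = φ x * (v x - v y) + (φ x - φ y) * v y := by ring
      have e2 := abs_add_rpow hη hr.le le_rfl (φ x * (v x - v y)) ((φ x - φ y) * v y)
      rw [← e1, abs_mul, abs_mul, Real.mul_rpow (abs_nonneg _) (abs_nonneg _), Real.mul_rpow (abs_nonneg _) (abs_nonneg _), abs_of_nonneg hφr] at e2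
      have e3 : |φ x - φ y| ^ r ≤ (L:ℝ)^r * dist x y ^ r := by
        rw [← Real.mul_rpow (by positivity) (by positivity)]
        apply Real.rpow_le_rpow (abs_nonneg _) _ (by linarith)
        have := hL.dist_le_mul x y
        rwa [Real.dist_eq] at this
      have e4 : dist x y ^ (a - (N:ℝ)) = dist x y ^ r / dist x y ^ ((N:ℝ) + s * r) := by
        rw [← Real.rpow_sub hd0]; congr 1; rw [ha]; ring
      rw [e4]
      have hD : 0 < dist x y ^ ((N:ℝ) + s * r) := by positivity
      calc |φ x * v x - φ y * v y| ^ r / dist x y ^ ((N:ℝ) + s * r)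
          ≤ ((1 + η) ^ r * (φ x ^ r * |v x - v y| ^ r) + (1 + 1 / η) ^ r * (((L:ℝ)^r * dist x y ^ r) * |v y| ^ r)) / dist x y ^ ((N:ℝ) + s * r) := by
            gcongr
            refine e2.trans ?_
            gcongr
        _ = _ := by ring
    · have hz : φ y = 0 := by
        by_contra hne
        exact hy (Metric.ball_subset_ball (by linarith) (hsupp y hne))
      have hz' : φ x = 0 := by
        by_contra hne
        apply hy
        have := hsupp x hne
        simp only [Metric.mem_ball] at this ⊢
        have := dist_triangle_left y 0 x
        linarith
      have : (0:ℝ) ^ r = 0 := Real.zero_rpow (by linarith)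
      simp [hz, hz', this]
  have hpt2 : ∀ x, Gf s r e (fun y => φ y * v y) x ≤
      ENNReal.ofReal ((1 + η) ^ r) * (ENNReal.ofReal (φ x ^ r) * Gf s r e v x)
      + ENNReal.ofReal ((1 + 1/η)^r * (L:ℝ)^r) * ∫⁻ y, (h y * kz e a (x - y)) := by
    intro x
    have hnm : Measurable (nk s r e v x) := measurable_nk_right s r e hv x
    have hkm := measurable_kz (N := N) e a
    have e1 : ∫⁻ y, nk s r e (fun y => φ y * v y) x y ≤ ENNReal.ofReal ((1 + η) ^ r) * (ENNReal.ofReal (φ x ^ r) * ∫⁻ y, nk s r e v x y)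
      + ENNReal.ofReal ((1 + 1/η)^r * (L:ℝ)^r) * ∫⁻ y, (h y * kz e a (x - y)) := by
      refine (lintegral_mono (hpt x)).trans ?_
      have m3 : Measurable fun y => h y * kz e a (x - y) := hhm.mul (hkm.comp (measurable_const.sub measurable_id))
      rw [lintegral_add_left ((hnm.const_mul _).const_mul _), lintegral_const_mul _ (hnm.const_mul _), lintegral_const_mul _ hnm, lintegral_const_mul _ m3]
    have e2 : ENNReal.ofReal (|φ x * v x| ^ r) ≤ ENNReal.ofReal ((1 + η) ^ r) * (ENNReal.ofReal (φ x ^ r) * ENNReal.ofReal (|v x| ^ r)) := by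
      have := hφ.nonneg x
      rw [← ENNReal.ofReal_mul (by positivity), ← ENNReal.ofReal_mul (by positivity)]
      apply ENNReal.ofReal_le_ofReal
      rw [abs_mul, Real.mul_rpow (abs_nonneg _) (abs_nonneg _), abs_of_nonneg this]
      have : 1 ≤ (1 + η) ^ r := Real.one_le_rpow (by linarith) (by linarith)
      apply le_mul_of_one_le_left (by positivity) this
    unfold Gf
    refine (add_le_add e2 e1).trans (le_of_eq ?_)
    ring
  refine (lintegral_mono hpt2).trans ?_
  have hkm := measurable_kz (N := N) e a
  have hGm := measurable_Gf s r e hv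
  have m1 : Measurable fun x => ENNReal.ofReal (φ x ^ r) * Gf s r e v x := Measurable.mul (by fun_prop) hGm
  have m2 : Measurable fun x => ∫⁻ y, (h y * kz e a (x - y)) :=
    Measurable.lintegral_prod_right' (f := fun z : Euc N × Euc N => h z.2 * kz e a (z.1 - z.2))
      ((hhm.comp measurable_snd).mul (hkm.comp (measurable_fst.sub measurable_snd)))
  rw [lintegral_add_left (m1.const_mul _), lintegral_const_mul _ m1, lintegral_const_mul _ m2, lintegral_conv hkm hhm,
    hh, lintegral_indicator measurableSet_ball, mul_assoc]

structure PH {N : ℕ} (s pm r e : ℝ) (p : Euc N → Euc N → ℝ) : Prop where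
  hN : 0 < N
  hs : 0 < s
  hs1 : s < 1
  hpm : 1 < pm
  hpr : pm ≤ r
  hsr : s * r < N
  he : 0 < e
  he1 : e < 1
  cont : Continuous fun z : Euc N × Euc N => p z.1 z.2
  sym : ∀ x y, p x y = p y x
  lo : ∀ x y, pm ≤ p x y
  hi : ∀ x y, p x y ≤ r
  diag : ∀ x y, dist x y < e → p x y = r

lemma PH.self {N : ℕ} {s pm r e : ℝ} {p : Euc N → Euc N → ℝ} (H : PH s pm r e p) (x : Euc N) : p x x = r :=
  H.diag x x (by simpa using H.he)

lemma rpow_le_two {t a b c : ℝ} (ht : 0 ≤ t) (ha : 0 ≤ a) (hab : a ≤ b) (hbc : b ≤ c) : t ^ b ≤ t ^ a + t ^ c := by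
  rcases le_total t 1 with h | h
  · have : t ^ b ≤ t ^ a := by
      rcases ht.eq_or_lt with h0 | h0
      · subst h0
        rcases ha.eq_or_lt with h1 | h1
        · subst h1; rw [Real.rpow_zero]; exact Real.rpow_le_one le_rfl (by norm_num) hab
        · rw [Real.zero_rpow h1.ne', Real.zero_rpow (by linarith)]
      · exact Real.rpow_le_rpow_of_exponent_ge h0 h hab
    have := Real.rpow_nonneg ht c
    linarith
  · have := Real.rpow_le_rpow_of_exponent_le h hbc
    have := Real.rpow_nonneg ht a
    linarith

lemma measurable_sobKernel {N : ℕ} {s pm r e : ℝ} {p : Euc N → Euc N → ℝ} (H : PH s pm r e p)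
    {f : Euc N → ℝ} (hf : Measurable f) : Measurable (fun z : Euc N × Euc N => sobKernel s p f z.1 z.2) := by
  have := H.cont.measurable
  unfold sobKernel
  fun_prop

lemma measurable_sobKernel_right {N : ℕ} {s pm r e : ℝ} {p : Euc N → Euc N → ℝ} (H : PH s pm r e p)
    {f : Euc N → ℝ} (hf : Measurable f) (x : Euc N) : Measurable (sobKernel s p f x) := by
  have h : Measurable (fun y : Euc N => (x, y)) := measurable_prodMk_left
  have h2 := (measurable_sobKernel H hf).comp h
  exact h2

lemma nk_le_sobKernel {N : ℕ} {s pm r e : ℝ} {p : Euc N → Euc N → ℝ} (H : PH s pm r e p)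
    (f : Euc N → ℝ) (x y : Euc N) : nk s r e f x y ≤ sobKernel s p f x y := by
  unfold nk sobKernel
  split_ifs with h
  · rw [H.diag x y h]
  · exact zero_le

set_option maxHeartbeats 1000000 in
lemma far_energy {N : ℕ} {s pm r e : ℝ} {p : Euc N → Euc N → ℝ} (H : PH s pm r e p) :
    ∃ C : ℝ≥0∞, C ≠ ⊤ ∧ ∀ f : Euc N → ℝ, Measurable f →
      sobModular univ s p f ≤ (∫⁻ x, Gf s r e f x) + C * ∫⁻ x, (ENNReal.ofReal (|f x| ^ pm) + ENNReal.ofReal (|f x| ^ r)) := by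
  have hs := H.hs
  have hpm := H.hpm
  have hpr := H.hpr
  have he := H.he
  have he1 := H.he1
  set a := s * pm with ha
  have ha0 : 0 < a := by positivity
  set K := (2:ℝ)^r * (e ^ (-((N:ℝ) + s * r)) * (1 + e) ^ ((N:ℝ) + a)) with hK
  have hK0 : 0 ≤ K := by positivity
  refine ⟨2 * (ENNReal.ofReal K * ∫⁻ z : Euc N, kf a z), ENNReal.mul_ne_top (by simp) (ENNReal.mul_ne_top ENNReal.ofReal_ne_top (kf_fin ha0).ne), ?_⟩
  intro f hf
  set h : Euc N → ℝ≥0∞ := fun x => (ENNReal.ofReal (|f x| ^ pm) + ENNReal.ofReal (|f x| ^ r)) with hh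
  have hhm : Measurable h := by fun_prop
  have hpt : ∀ x y, sobKernel s p f x y ≤ nk s r e f x y + ENNReal.ofReal K * (h x * kf a (x - y) + h y * kf a (x - y)) := by
    intro x y
    unfold nk sobKernel
    split_ifs with hd
    · rw [H.diag x y hd]; exact le_self_add
    rw [zero_add, ← add_mul]
    push Not at hd
    rw [hh]
    simp only
    rw [← ENNReal.ofReal_add (by positivity) (by positivity), ← ENNReal.ofReal_add (by positivity) (by positivity),
      ← ENNReal.ofReal_add (by positivity) (by positivity), kf, ← ENNReal.ofReal_mul (by positivity), ← ENNReal.ofReal_mul (by positivity)]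
    apply ENNReal.ofReal_le_ofReal
    rw [← dist_eq_norm]
    have hD : 0 < dist x y := by linarith
    have hlo := H.lo x y
    have hhi := H.hi x y
    generalize p x y = P at *
    generalize dist x y = D at *
    have e1 : |f x - f y| ^ P ≤ 2 ^ r * (|f x| ^ pm + |f x| ^ r + (|f y| ^ pm + |f y| ^ r)) := by
      have := abs_add_rpow (η := 1) one_pos (by linarith : 1 ≤ P) hhi (f x) (- f y)
      rw [abs_neg, ← sub_eq_add_neg] at this
      norm_num at this
      have i1 := rpow_le_two (abs_nonneg (f x)) (by linarith : 0 ≤ pm) hlo hhi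
      have i2 := rpow_le_two (abs_nonneg (f y)) (by linarith : 0 ≤ pm) hlo hhi
      refine this.trans ?_
      rw [← mul_add]
      gcongr
    have e2 : (D ^ ((N:ℝ) + s * P))⁻¹ ≤ e ^ (-((N:ℝ) + s * r)) * (1 + e) ^ ((N:ℝ) + a) * (1 + D) ^ (-((N:ℝ) + a)) := by
      rw [Real.rpow_neg he.le, Real.rpow_neg (by positivity), ← mul_inv_le_iff₀ (by positivity), inv_inv, mul_comm (_⁻¹) (_ ^ _), ← div_eq_mul_inv, ]
      rw [div_le_iff₀ (by positivity), mul_assoc, le_inv_mul_iff₀ (by positivity), mul_comm (e ^ _)]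
      have f1 : D = e * (D / e) := by field_simp
      have f2 : D ^ ((N:ℝ) + s * P) = e ^ ((N:ℝ) + s * P) * (D/e) ^ ((N:ℝ) + s * P) := by
        rw [← Real.mul_rpow he.le (by positivity), ← f1]
      have f3 : e ^ ((N:ℝ) + s * r) ≤ e ^ ((N:ℝ) + s * P) :=
        Real.rpow_le_rpow_of_exponent_ge he he1.le (by gcongr)
      have f4 : (D/e) ^ ((N:ℝ) + a) ≤ (D/e) ^ ((N:ℝ) + s * P) :=
        Real.rpow_le_rpow_of_exponent_le (by rw [le_div_iff₀ he]; linarith) (by rw [ha]; gcongr)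
      have f5 : ((1 + D)) ^ ((N:ℝ) + a) ≤ (D/e) ^ ((N:ℝ) + a) * (1+e) ^ ((N:ℝ) + a) := by
        rw [← Real.mul_rpow (by positivity) (by positivity)]
        apply Real.rpow_le_rpow (by positivity) _ (by positivity)
        rw [div_mul_eq_mul_div, le_div_iff₀ he]; nlinarith
      rw [f2]
      calc (1 + D) ^ ((N:ℝ) + a) * e ^ ((N:ℝ) + s * r) ≤ ((D/e) ^ ((N:ℝ) + a) * (1+e) ^ ((N:ℝ) + a)) * e ^ ((N:ℝ) + s * P) := by gcongr
        _ ≤ ((D/e) ^ ((N:ℝ) + s * P) * (1+e) ^ ((N:ℝ) + a)) * e ^ ((N:ℝ) + s * P) := by gcongr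
        _ = _ := by ring
    calc |f x - f y| ^ P / D ^ ((N:ℝ) + s * P) = |f x - f y| ^ P * (D ^ ((N:ℝ) + s * P))⁻¹ := by rw [div_eq_mul_inv]
      _ ≤ (2 ^ r * (|f x| ^ pm + |f x| ^ r + (|f y| ^ pm + |f y| ^ r))) * (e ^ (-((N:ℝ) + s * r)) * (1 + e) ^ ((N:ℝ) + a) * (1 + D) ^ (-((N:ℝ) + a))) := by gcongr
      _ = _ := by rw [hK]; ring
  have hkm := measurable_kf (N := N) a
  have m1 : Measurable fun z : Euc N × Euc N => h z.1 * kf a (z.1 - z.2) :=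
    (hhm.comp measurable_fst).mul (hkm.comp (measurable_fst.sub measurable_snd))
  have m2 : Measurable fun z : Euc N × Euc N => h z.2 * kf a (z.1 - z.2) :=
    (hhm.comp measurable_snd).mul (hkm.comp (measurable_fst.sub measurable_snd))
  have hpt2 : ∀ x, ENNReal.ofReal (|f x| ^ (p x x)) + ∫⁻ y, sobKernel s p f x y ≤ Gf s r e f x + ENNReal.ofReal K * ((∫⁻ y, h x * kf a (x - y)) + ∫⁻ y, h y * kf a (x - y)) := by
    intro x
    rw [H.self, Gf, add_assoc]
    gcongr
    refine (lintegral_mono (hpt x)).trans ?_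
    have n1 : Measurable fun y => h x * kf a (x - y) := (hkm.comp (measurable_const.sub measurable_id)).const_mul _
    have n2 : Measurable fun y => h y * kf a (x - y) := hhm.mul (hkm.comp (measurable_const.sub measurable_id))
    have n3 : Measurable fun y => h x * kf a (x - y) + h y * kf a (x - y) := n1.add n2
    rw [lintegral_add_left (measurable_nk_right s r e hf x), lintegral_const_mul _ n3, lintegral_add_left n1]
  have hsm : sobModular univ s p f = ∫⁻ x, (ENNReal.ofReal (|f x| ^ (p x x)) + ∫⁻ y, sobKernel s p f x y) := by
    unfold sobModular
    simp only [Measure.restrict_univ]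
    rw [lintegral_add_left]
    simp only [H.self]; fun_prop
  rw [hsm]
  refine (lintegral_mono hpt2).trans ?_
  have q1 := Measurable.lintegral_prod_right' (ν := (volume : Measure (Euc N))) m1
  have q2 := Measurable.lintegral_prod_right' (ν := (volume : Measure (Euc N))) m2
  simp only at q1 q2
  have q3 : Measurable fun x => (∫⁻ y, h x * kf a (x - y)) + ∫⁻ y, h y * kf a (x - y) := q1.add q2
  rw [lintegral_add_left (measurable_Gf s r e hf), lintegral_const_mul _ q3, lintegral_add_left q1, lintegral_conv hkm hhm]
  have c1 : ∫⁻ x, ∫⁻ y, h x * kf a (x - y) = (∫⁻ z : Euc N, kf a z) * ∫⁻ x, h x := by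
    have : ∀ x, ∫⁻ y, h x * kf a (x - y) = h x * ∫⁻ z : Euc N, kf a z := by
      intro x
      have n1 : Measurable fun y => kf a (x - y) := hkm.comp (measurable_const.sub measurable_id)
      rw [lintegral_const_mul _ n1, lintegral_sub_left_eq_self]
    simp_rw [this]
    rw [lintegral_mul_const _ hhm, mul_comm]
  rw [c1]
  apply le_of_eq
  ring

lemma Gf_div {N : ℕ} {s r e : ℝ} (f : Euc N → ℝ) {c : ℝ} (hc : 0 < c) (hf : Measurable f) (x : Euc N) :
    Gf s r e (fun y => f y / c) x = ENNReal.ofReal (c ^ (-r)) * Gf s r e f x := by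
  unfold Gf
  have h1 : ∀ t : ℝ, |t / c| ^ r = c ^ (-r) * |t| ^ r := by
    intro t
    rw [abs_div, abs_of_pos hc, Real.div_rpow (abs_nonneg _) hc.le, Real.rpow_neg hc.le]; ring
  have h2 : ∀ y, nk s r e (fun y => f y / c) x y = ENNReal.ofReal (c ^ (-r)) * nk s r e f x y := by
    intro y
    unfold nk
    split_ifs
    · rw [← sub_div, h1, mul_div_assoc, ENNReal.ofReal_mul (by positivity)]
    · simp
  simp_rw [h2, h1]
  rw [lintegral_const_mul _ (measurable_nk_right s r e hf x), ENNReal.ofReal_mul (by positivity), mul_add]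

lemma mod_scale {N : ℕ} {s pm r e : ℝ} {p : Euc N → Euc N → ℝ} (H : PH s pm r e p) {f g : Euc N → ℝ} {K : ℝ} (hK : 0 ≤ K)
    (h : ∀ P, pm ≤ P → P ≤ r → (∀ x, |f x| ^ P ≤ K * |g x| ^ P) ∧ ∀ x y, |f x - f y| ^ P ≤ K * |g x - g y| ^ P) :
    sobModular univ s p f ≤ ENNReal.ofReal K * sobModular univ s p g := by
  unfold sobModular
  rw [mul_add, ← lintegral_const_mul' _ _ ENNReal.ofReal_ne_top, ← lintegral_const_mul' _ _ ENNReal.ofReal_ne_top]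
  gcongr with x x
  · rw [← ENNReal.ofReal_mul hK]
    exact ENNReal.ofReal_le_ofReal ((h _ (H.lo x x) (H.hi x x)).1 x)
  · rw [← lintegral_const_mul' _ _ ENNReal.ofReal_ne_top]
    gcongr with y
    unfold sobKernel
    rw [← ENNReal.ofReal_mul hK]
    apply ENNReal.ofReal_le_ofReal
    rw [← mul_div_assoc]
    gcongr
    exact (h _ (H.lo x y) (H.hi x y)).2 x y

lemma mod_div {N : ℕ} {s pm r e : ℝ} {p : Euc N → Euc N → ℝ} (H : PH s pm r e p) (f : Euc N → ℝ) {c : ℝ} (hc : 1 ≤ c) :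
    sobModular univ s p (fun x => f x / c) ≤ ENNReal.ofReal (c ^ (-pm)) * sobModular univ s p f := by
  have hc0 : 0 < c := by linarith
  have key : ∀ P, pm ≤ P → ∀ t : ℝ, |t / c| ^ P ≤ c ^ (-pm) * |t| ^ P := by
    intro P hP t
    rw [abs_div, abs_of_pos hc0, Real.div_rpow (abs_nonneg _) hc0.le, div_eq_mul_inv, ← Real.rpow_neg hc0.le, mul_comm]
    gcongr
  refine mod_scale H (by positivity) fun P h1 h2 => ⟨fun x => key P h1 _, fun x y => ?_⟩
  rw [← sub_div]; exact key P h1 _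

lemma mod_mul {N : ℕ} {s pm r e : ℝ} {p : Euc N → Euc N → ℝ} (H : PH s pm r e p) (f : Euc N → ℝ) {c d : ℝ} (hc : 0 < c)
    (hcd : c ≤ d) (hd : 1 ≤ d) :
    sobModular univ s p f ≤ ENNReal.ofReal (d ^ r) * sobModular univ s p (fun x => f x / c) := by
  have hd0 : 0 < d := by linarith
  have hpm := H.hpm
  have key : ∀ P, pm ≤ P → P ≤ r → ∀ t : ℝ, |t| ^ P ≤ d ^ r * |t / c| ^ P := by
    intro P hP hP2 t
    have e1 : |t| = c * |t / c| := by rw [abs_div, abs_of_pos hc]; field_simp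
    rw [e1, Real.mul_rpow hc.le (abs_nonneg _)]
    gcongr
    calc c ^ P ≤ d ^ P := Real.rpow_le_rpow hc.le hcd (by linarith)
      _ ≤ d ^ r := Real.rpow_le_rpow_of_exponent_le hd hP2
  refine mod_scale H (by positivity) fun P h1 h2 => ⟨fun x => key P h1 h2 _, fun x y => ?_⟩
  rw [← sub_div]; exact key P h1 h2 _

lemma normset_nonempty {N : ℕ} {s pm r e : ℝ} {p : Euc N → Euc N → ℝ} (H : PH s pm r e p) {f : Euc N → ℝ}
    (hf : sobModular univ s p f < ⊤) : {c : ℝ | 0 < c ∧ sobModular univ s p (fun x => f x / c) ≤ 1}.Nonempty := by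
  set m := (sobModular univ s p f).toReal with hm
  have hm0 : 0 ≤ m := ENNReal.toReal_nonneg
  have hpm := H.hpm
  refine ⟨1 + m, by positivity, (mod_div H f (by linarith)).trans ?_⟩
  rw [← ENNReal.ofReal_toReal hf.ne, ← ENNReal.ofReal_mul (by positivity), ← hm, ENNReal.ofReal_le_one, Real.rpow_neg (by positivity),
    inv_mul_le_iff₀ (by positivity), mul_one]
  calc m ≤ 1 + m := by linarith
    _ ≤ _ := Real.self_le_rpow_of_one_le (by linarith) hpm.le

lemma mod_bound {N : ℕ} {s pm r e : ℝ} {p : Euc N → Euc N → ℝ} (H : PH s pm r e p) {f : Euc N → ℝ}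
    (hf : sobModular univ s p f < ⊤) {C : ℝ} (hC : sobNorm univ s p f ≤ C) :
    sobModular univ s p f ≤ ENNReal.ofReal ((max 1 (C + 1)) ^ r) := by
  obtain ⟨c, ⟨hc0, hc⟩, hcC⟩ := exists_lt_of_csInf_lt (normset_nonempty H hf) (show sInf _ < C + 1 by
    have : sobNorm univ s p f < C + 1 := by linarith
    exact this)
  refine (mod_mul H f hc0 (hcC.le.trans (le_max_right 1 _)) (le_max_left _ _)).trans ?_
  calc _ ≤ ENNReal.ofReal ((max 1 (C + 1)) ^ r) * 1 := by gcongr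
    _ = _ := mul_one _

lemma ball_int {N : ℕ} {s pm r e : ℝ} {p : Euc N → Euc N → ℝ} (H : PH s pm r e p) {f : Euc N → ℝ}
    (hf : MemSob univ s p f) (x : Euc N) (ε : ℝ) : IntegrableOn f (Metric.ball x ε) ∧
    ∫⁻ y in Metric.ball x ε, ENNReal.ofReal |f y| ≤ volume (Metric.ball x ε) + sobModular univ s p f := by
  have hpm := H.hpm
  have hpr := H.hpr
  have h1 : ∫⁻ y in Metric.ball x ε, ENNReal.ofReal |f y| ≤ volume (Metric.ball x ε) + sobModular univ s p f := by
    calc ∫⁻ y in Metric.ball x ε, ENNReal.ofReal |f y| ≤ ∫⁻ y in Metric.ball x ε, (1 + ENNReal.ofReal (|f y| ^ (p y y))) := by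
          gcongr with y
          rw [← ENNReal.ofReal_one, ← ENNReal.ofReal_add (by norm_num) (by positivity)]
          apply ENNReal.ofReal_le_ofReal
          rw [H.self]
          have := rpow_le_two (abs_nonneg (f y)) le_rfl zero_le_one (by linarith : 1 ≤ r)
          simpa using this
      _ = volume (Metric.ball x ε) + ∫⁻ y in Metric.ball x ε, ENNReal.ofReal (|f y| ^ (p y y)) := by
          rw [lintegral_add_left measurable_const]; simp
      _ ≤ _ := by
          gcongr
          unfold sobModular
          refine le_trans ?_ le_self_add
          exact lintegral_mono_set (subset_univ _)
  refine ⟨⟨?_, ?_⟩, h1⟩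
  · have := hf.1
    rw [Measure.restrict_univ] at this
    exact this.restrict
  · rw [hasFiniteIntegral_iff_norm]
    exact h1.trans_lt (ENNReal.add_lt_top.2 ⟨measure_ball_lt_top, hf.2⟩)

lemma memSob_div {N : ℕ} {s pm r e : ℝ} {p : Euc N → Euc N → ℝ} (H : PH s pm r e p) {f : Euc N → ℝ}
    (hf : MemSob univ s p f) (c : ℝ) (h : sobModular univ s p (fun x => f x / c) ≤ 1) : MemSob univ s p (fun x => f x / c) :=
  ⟨by simpa [div_eq_mul_inv] using hf.1.mul_const c⁻¹, h.trans_lt ENNReal.one_lt_top⟩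

lemma ball_func {N : ℕ} {s pm r e : ℝ} {p : Euc N → Euc N → ℝ} (H : PH s pm r e p) (x : Euc N) (ε : ℝ) :
    IsBddLinFunc s p (fun f => ∫ y in Metric.ball x ε, f y) := by
  refine ⟨fun f g hf hg => ?_, fun c f hf => ?_, (volume (Metric.ball x ε)).toReal + 1, fun f hf => ?_⟩
  · exact integral_add (ball_int H hf x ε).1 (ball_int H hg x ε).1
  · simp [integral_const_mul]
  · rw [mul_comm, ← div_le_iff₀ (by positivity)]
    refine le_csInf (normset_nonempty H hf.2) ?_
    rintro c ⟨hc0, hc⟩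
    rw [div_le_iff₀ (by positivity)]
    have h1 := ball_int H (memSob_div H hf c hc) x ε
    have h2 : |∫ y in Metric.ball x ε, f y / c| ≤ (volume (Metric.ball x ε)).toReal + 1 := by
      rw [← Real.norm_eq_abs]
      refine (norm_integral_le_lintegral_norm _).trans ?_
      refine ENNReal.toReal_le_of_le_ofReal (by positivity) ?_
      refine (h1.2.trans (add_le_add_right hc _)).trans (le_of_eq ?_)
      rw [ENNReal.ofReal_add (by positivity) (by norm_num), ENNReal.ofReal_toReal measure_ball_lt_top.ne]; simp
    rw [integral_div, abs_div, abs_of_pos hc0, div_le_iff₀ hc0] at h2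
    linarith

lemma Gf_add {N : ℕ} {s r e η : ℝ} (hη : 0 < η) (hr : 1 < r) {f g : Euc N → ℝ} (hf : Measurable f) (hg : Measurable g) (x : Euc N) :
    Gf s r e (fun y => f y + g y) x ≤ ENNReal.ofReal ((1+η)^r) * Gf s r e f x + ENNReal.ofReal ((1+1/η)^r) * Gf s r e g x := by
  have hη' : 0 < 1 + 1/η := by positivity
  have h1 : ∀ y, nk s r e (fun y => f y + g y) x y ≤ ENNReal.ofReal ((1+η)^r) * nk s r e f x y + ENNReal.ofReal ((1+1/η)^r) * nk s r e g x y := by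
    intro y
    unfold nk
    split_ifs
    · rw [← ENNReal.ofReal_mul (by positivity), ← ENNReal.ofReal_mul (by positivity), ← ENNReal.ofReal_add (by positivity) (by positivity)]
      apply ENNReal.ofReal_le_ofReal
      rw [← mul_div_assoc, ← mul_div_assoc, ← add_div]
      gcongr
      rw [add_sub_add_comm]
      exact abs_add_rpow hη hr.le le_rfl _ _
    · simp
  have mf := measurable_nk_right s r e hf x
  have mg := measurable_nk_right s r e hg x
  have h2 := lintegral_mono (μ := (volume : Measure (Euc N))) h1
  rw [lintegral_add_left (mf.const_mul _), lintegral_const_mul _ mf, lintegral_const_mul _ mg] at h2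
  have h3 : ENNReal.ofReal (|f x + g x| ^ r) ≤ ENNReal.ofReal ((1+η)^r) * ENNReal.ofReal (|f x| ^ r) + ENNReal.ofReal ((1+1/η)^r) * ENNReal.ofReal (|g x| ^ r) := by
    rw [← ENNReal.ofReal_mul (by positivity), ← ENNReal.ofReal_mul (by positivity), ← ENNReal.ofReal_add (by positivity) (by positivity)]
    exact ENNReal.ofReal_le_ofReal (abs_add_rpow hη hr.le le_rfl _ _)
  unfold Gf
  refine (add_le_add h3 h2).trans (le_of_eq ?_)
  ring

lemma Gf_neg {N : ℕ} {s r e : ℝ} (f : Euc N → ℝ) (x : Euc N) : Gf s r e (fun y => - f y) x = Gf s r e f x := by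
  unfold Gf nk
  simp only [abs_neg]
  congr 2 with y
  rw [neg_sub_neg, abs_sub_comm]

def UE {N : ℕ} (s : ℝ) (p : Euc N → Euc N → ℝ) (r : ℝ) (f : Euc N → ℝ) (x : Euc N) : ℝ≥0∞ :=
  ENNReal.ofReal (|f x| ^ r) + ∫⁻ y, sobKernel s p f x y

lemma measurable_UE {N : ℕ} {s pm r e : ℝ} {p : Euc N → Euc N → ℝ} (H : PH s pm r e p) {f : Euc N → ℝ} (hf : Measurable f) :
    Measurable (UE s p r f) := by
  unfold UE
  have h0 : Measurable (fun x => ENNReal.ofReal (|f x| ^ r)) := by fun_prop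
  refine h0.add ?_
  exact Measurable.lintegral_prod_right' (measurable_sobKernel H hf)

lemma Gf_le_UE {N : ℕ} {s pm r e : ℝ} {p : Euc N → Euc N → ℝ} (H : PH s pm r e p) (f : Euc N → ℝ) (x : Euc N) :
    Gf s r e f x ≤ UE s p r f x := by
  unfold Gf UE
  gcongr with y
  exact nk_le_sobKernel H f x y

lemma lintegral_UE {N : ℕ} {s pm r e : ℝ} {p : Euc N → Euc N → ℝ} (H : PH s pm r e p) {f : Euc N → ℝ} (hf : Measurable f) :
    ∫⁻ x, UE s p r f x = sobModular univ s p f := by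
  unfold UE sobModular
  simp only [Measure.restrict_univ, H.self]
  rw [lintegral_add_left]
  fun_prop

structure CT {N : ℕ} (φ : Euc N → ℝ) : Prop where
  cont : Continuous φ
  nonneg : ∀ x, 0 ≤ φ x
  le_one : ∀ x, φ x ≤ 1
  supp : ∃ R : ℝ, 0 < R ∧ ∀ x, φ x ≠ 0 → x ∈ Metric.ball (0 : Euc N) R

lemma IsTest.ct {N : ℕ} {φ : Euc N → ℝ} (h : IsTest φ) : CT φ := ⟨h.cont, h.nonneg, h.le_one, h.supp⟩

lemma CT.rpow {N : ℕ} {φ : Euc N → ℝ} (h : CT φ) {a : ℝ} (ha : 0 < a) : CT (fun x => φ x ^ a) := by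
  refine ⟨h.cont.rpow_const fun x => Or.inr ha.le, fun x => Real.rpow_nonneg (h.nonneg x) _,
    fun x => Real.rpow_le_one (h.nonneg x) (h.le_one x) ha.le, ?_⟩
  obtain ⟨R, hR, h2⟩ := h.supp
  refine ⟨R, hR, fun x hx => h2 x fun h0 => hx ?_⟩
  simp only [h0]; exact Real.zero_rpow ha.ne'

structure CH0 {N : ℕ} (s pm r e : ℝ) (p : Euc N → Euc N → ℝ) (rs : ℝ) (q : Euc N → ℝ) (un : ℕ → Euc N → ℝ) (u : Euc N → ℝ)
    (μ ν : Measure (Euc N)) (M : ℝ≥0∞) : Prop where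
  H : PH s pm r e p
  hrs : rs = N * r / (N - s * r)
  qc : Continuous q
  qlo : ∀ x, pm ≤ q x
  qhi : ∀ x, q x ≤ rs
  mun : ∀ n, Measurable (un n)
  mu : Measurable u
  hMt : M ≠ ⊤
  hM : ∀ n, sobModular univ s p (un n) ≤ M
  hMu : sobModular univ s p u ≤ M
  avg : ∀ x ε, 0 < ε → Tendsto (fun n => ∫ y in Metric.ball x ε, (un n y - u y)) atTop (𝓝 0)
  fμ : IsFiniteMeasure μ
  fν : IsFiniteMeasure ν
  hμ : ∀ φ, CT φ → Tendsto (fun n => ∫⁻ x, ENNReal.ofReal (φ x) * UE s p r (un n) x) atTop (𝓝 (∫⁻ x, ENNReal.ofReal (φ x) ∂μ))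
  hν : ∀ φ, CT φ → Tendsto (fun n => ∫⁻ x, ENNReal.ofReal (φ x) * ENNReal.ofReal (|un n x| ^ q x)) atTop (𝓝 (∫⁻ x, ENNReal.ofReal (φ x) ∂ν))

section
variable {N : ℕ} {s pm r e : ℝ} {p : Euc N → Euc N → ℝ} {rs : ℝ} {q : Euc N → ℝ} {un : ℕ → Euc N → ℝ} {u : Euc N → ℝ}
    {μ ν : Measure (Euc N)} {M : ℝ≥0∞}

lemma CH0.r1 (h : CH0 s pm r e p rs q un u μ ν M) : 1 < r := lt_of_lt_of_le h.H.hpm h.H.hpr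

lemma CH0.rrs (h : CH0 s pm r e p rs q un u μ ν M) : r < rs := by
  have h1 := h.H.hsr
  have h2 := h.r1
  have h3 := h.H.hs
  have hN : (0:ℝ) < N := by exact_mod_cast h.H.hN
  rw [h.hrs, lt_div_iff₀ (by linarith)]
  have : 0 < s * r * r := by positivity
  nlinarith

lemma CH0.mv (h : CH0 s pm r e p rs q un u μ ν M) (n : ℕ) : Measurable (fun x => un n x - u x) := (h.mun n).sub h.mu

lemma CH0.Gv (h : CH0 s pm r e p rs q un u μ ν M) {η : ℝ} (hη : 0 < η) (n : ℕ) (x : Euc N) :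
    Gf s r e (fun x => un n x - u x) x ≤ ENNReal.ofReal ((1+η)^r) * UE s p r (un n) x + ENNReal.ofReal ((1+1/η)^r) * UE s p r u x := by
  have := Gf_add (s := s) (e := e) hη h.r1 (h.mun n) (f := un n) (g := fun x => - u x) h.mu.neg x
  simp only [← sub_eq_add_neg] at this
  refine this.trans ?_
  rw [Gf_neg]
  gcongr
  · exact Gf_le_UE h.H _ _
  · exact Gf_le_UE h.H _ _

lemma CH0.venergy (h : CH0 s pm r e p rs q un u μ ν M) : ∃ M' : ℝ≥0∞, M' ≠ ⊤ ∧ ∀ n, ∫⁻ x, Gf s r e (fun x => un n x - u x) x ≤ M' := by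
  refine ⟨ENNReal.ofReal ((1+1)^r) * M + ENNReal.ofReal ((1+1/1)^r) * M,
    ENNReal.add_ne_top.2 ⟨ENNReal.mul_ne_top ENNReal.ofReal_ne_top h.hMt, ENNReal.mul_ne_top ENNReal.ofReal_ne_top h.hMt⟩, fun n => ?_⟩
  have m1 := measurable_UE h.H (h.mun n)
  have m2 := measurable_UE h.H h.mu
  refine (lintegral_mono (h.Gv one_pos n)).trans ?_
  rw [lintegral_add_left (m1.const_mul _), lintegral_const_mul _ m1, lintegral_const_mul _ m2, lintegral_UE h.H (h.mun n), lintegral_UE h.H h.mu]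
  gcongr
  · exact h.hM n
  · exact h.hMu

lemma CH0.vw (h : CH0 s pm r e p rs q un u μ ν M) (w : Euc N → ℝ≥0∞) (hw : Measurable w) (hw1 : ∀ x, w x ≤ 1) (hwi : ∫⁻ x, w x ≠ ⊤) :
    Tendsto (fun n => ∫⁻ x, w x * ENNReal.ofReal (|un n x - u x| ^ r)) atTop (𝓝 0) := by
  obtain ⟨M', h1, h2⟩ := h.venergy
  exact local_compact h.H.hN h.H.hs h.r1 h.H.he (fun n x => un n x - u x) h.mv h1 h2 h.avg w hw hw1 hwi

lemma CH0.vloc (h : CH0 s pm r e p rs q un u μ ν M) (R : ℝ) :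
    Tendsto (fun n => ∫⁻ x in Metric.ball 0 R, ENNReal.ofReal (|un n x - u x| ^ r)) atTop (𝓝 0) := by
  have := h.vw ((Metric.ball 0 R).indicator fun _ => 1) (measurable_const.indicator measurableSet_ball)
    (fun x => indicator_le_self' (by simp) x) (by rw [lintegral_indicator measurableSet_ball]; simpa using measure_ball_lt_top.ne)
  refine this.congr fun n => ?_
  rw [← lintegral_indicator measurableSet_ball]
  congr 1 with x
  by_cases hx : x ∈ Metric.ball 0 R
  · simp [indicator_of_mem hx]
  · simp [indicator_of_notMem hx]

lemma CH0.vlocpm (h : CH0 s pm r e p rs q un u μ ν M) (R : ℝ) :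
    Tendsto (fun n => ∫⁻ x in Metric.ball 0 R, ENNReal.ofReal (|un n x - u x| ^ pm)) atTop (𝓝 0) := by
  have hpm := h.H.hpm
  rcases h.H.hpr.eq_or_lt with heq | hlt
  · rw [heq]; exact h.vloc R
  have ha : 1 < r / pm := by rw [lt_div_iff₀ (by linarith)]; linarith
  have key : ∀ n, ∫⁻ x in Metric.ball 0 R, ENNReal.ofReal (|un n x - u x| ^ pm) ≤
      (∫⁻ x in Metric.ball 0 R, ENNReal.ofReal (|un n x - u x| ^ r)) ^ (1 / (r/pm)) * volume (Metric.ball (0 : Euc N) R) ^ (1 - 1/(r/pm)) := by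
    intro n
    have := h.mv n
    have h1 := holder_one (volume.restrict (Metric.ball (0 : Euc N) R)) ha (h := fun x => ENNReal.ofReal (|un n x - u x| ^ pm)) (ENNReal.measurable_ofReal.comp (this.norm.pow_const pm)).aemeasurable
    simp only [Measure.restrict_apply_univ] at h1
    refine h1.trans (le_of_eq ?_)
    congr 3 with x
    rw [ENNReal.ofReal_rpow_of_nonneg (by positivity) (by positivity), ← Real.rpow_mul (abs_nonneg _)]
    congr 2; field_simp
  have h0 := ((ENNReal.continuous_rpow_const (y := 1/(r/pm))).tendsto 0).comp (h.vloc R)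
  rw [ENNReal.zero_rpow_of_pos (by positivity)] at h0
  have h1 := ENNReal.Tendsto.mul_const (b := volume (Metric.ball (0 : Euc N) R) ^ (1 - 1/(r/pm))) h0 (Or.inr (by
    apply ENNReal.rpow_ne_top_of_nonneg
    · rw [sub_nonneg, div_le_one (by positivity)]; exact ha.le
    · exact measure_ball_lt_top.ne))
  rw [zero_mul] at h1
  exact tendsto_of_tendsto_of_tendsto_of_le_of_le tendsto_const_nhds h1 (fun _ => zero_le) key

lemma CH0.subseq (h : CH0 s pm r e p rs q un u μ ν M) : ∃ ns : ℕ → ℕ, StrictMono ns ∧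
    ∀ᵐ x, Tendsto (fun k => un (ns k) x) atTop (𝓝 (u x)) := by
  have hw := h.vw (kf 1) (measurable_kf 1) (fun x => by
    unfold kf
    rw [ENNReal.ofReal_le_one]
    apply Real.rpow_le_one_of_one_le_of_nonpos
    · linarith [norm_nonneg x]
    · have : (0:ℝ) ≤ N := Nat.cast_nonneg N
      linarith) (kf_fin one_pos).ne
  have hr := h.r1
  set m := (volume : Measure (Euc N)).withDensity (kf 1) with hm
  have hTM : TendstoInMeasure m un atTop u := by
    refine tendstoInMeasure_of_tendsto_eLpNorm (p := ENNReal.ofReal r) (by simp; linarith) (fun n => (h.mun n).aestronglyMeasurable) h.mu.aestronglyMeasurable ?_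
    have e1 : ∀ n, eLpNorm (un n - u) (ENNReal.ofReal r) m = (∫⁻ x, kf 1 x * ENNReal.ofReal (|un n x - u x| ^ r)) ^ (1/r) := by
      intro n
      rw [eLpNorm_eq_lintegral_rpow_enorm_toReal (by simp; linarith) ENNReal.ofReal_ne_top, ENNReal.toReal_ofReal (by linarith), hm,
        lintegral_withDensity_eq_lintegral_mul _ (measurable_kf 1) (((h.mun n).sub h.mu).enorm.pow_const r)]
      congr 2 with x
      simp only [Pi.mul_apply, Pi.sub_apply]
      rw [ofReal_rpow' _ _ (by linarith), ← Real.norm_eq_abs, ofReal_norm]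
    simp_rw [e1]
    have h0 := ((ENNReal.continuous_rpow_const (y := 1/r)).tendsto 0).comp hw
    rw [ENNReal.zero_rpow_of_pos (by positivity)] at h0
    exact h0
  obtain ⟨ns, h1, h2⟩ := hTM.exists_seq_tendsto_ae
  refine ⟨ns, h1, ?_⟩
  rw [hm, ae_withDensity_iff (measurable_kf 1)] at h2
  filter_upwards [h2] with x hx
  apply hx
  unfold kf
  have : 0 < 1 + ‖x‖ := by positivity
  simp; positivity

lemma CH0.sub (h : CH0 s pm r e p rs q un u μ ν M) {ns : ℕ → ℕ} (hn : StrictMono ns) : CH0 s pm r e p rs q (fun k => un (ns k)) u μ ν M where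
  H := h.H
  hrs := h.hrs
  qc := h.qc
  qlo := h.qlo
  qhi := h.qhi
  mun := fun n => h.mun _
  mu := h.mu
  hMt := h.hMt
  hM := fun n => h.hM _
  hMu := h.hMu
  avg := fun x ε hε => (h.avg x ε hε).comp hn.tendsto_atTop
  fμ := h.fμ
  fν := h.fν
  hμ := fun φ hφ => (h.hμ φ hφ).comp hn.tendsto_atTop
  hν := fun φ hφ => (h.hν φ hφ).comp hn.tendsto_atTop
end

lemma liminf_add_ge (a b : ℕ → ℝ≥0∞) : liminf a atTop + liminf b atTop ≤ liminf (fun n => a n + b n) atTop := by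
  simp only [liminf_eq_iSup_iInf_of_nat]
  rw [ENNReal.iSup_add_iSup]
  · refine iSup_mono fun n => le_iInf₂ fun i hi => ?_
    exact add_le_add (iInf₂_le i hi) (iInf₂_le i hi)
  · intro i j
    refine ⟨max i j, add_le_add ?_ ?_⟩
    · exact le_iInf₂ fun k hk => iInf₂_le k ((le_max_left i j).trans hk)
    · exact le_iInf₂ fun k hk => iInf₂_le k ((le_max_right i j).trans hk)

lemma test_lower {N : ℕ} {φ : Euc N → ℝ} {K : Set (Euc N)} (hK : MeasurableSet K) (h1 : ∀ x ∈ K, φ x = 1) (ρ : Measure (Euc N)) :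
    ρ K ≤ ∫⁻ x, ENNReal.ofReal (φ x) ∂ρ := by
  rw [← lintegral_indicator_one hK]
  refine lintegral_mono fun x => ?_
  by_cases hx : x ∈ K
  · simp [indicator_of_mem hx, h1 x hx]
  · simp [indicator_of_notMem hx]

lemma test_upper {N : ℕ} {φ : Euc N → ℝ} {K : Set (Euc N)} (hK : MeasurableSet K) (h0 : ∀ x, φ x ≤ 1) (h1 : ∀ x, φ x ≠ 0 → x ∈ K) (ρ : Measure (Euc N)) :
    ∫⁻ x, ENNReal.ofReal (φ x) ∂ρ ≤ ρ K := by
  rw [← lintegral_indicator_one hK]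
  refine lintegral_mono fun x => ?_
  by_cases hx : x ∈ K
  · simpa [indicator_of_mem hx] using h0 x
  · have : φ x = 0 := by by_contra h; exact hx (h1 x h)
    simp [this]

lemma le_of_tests {N : ℕ} {ρ σ : Measure (Euc N)} [IsFiniteMeasure σ]
    (h : ∀ φ, CT φ → ∫⁻ x, ENNReal.ofReal (φ x) ∂ρ ≤ ∫⁻ x, ENNReal.ofReal (φ x) ∂σ) : ρ ≤ σ := by
  apply le_of_compact
  intro K hK
  have ht := (tendsto_measure_cthickening_of_isCompact (μ := σ) hK).mono_left (nhdsWithin_le_nhds (s := Ioi 0))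
  refine ge_of_tendsto ht ?_
  filter_upwards [self_mem_nhdsWithin] with δ hδ
  obtain ⟨φ, h1, h2, h3⟩ := exists_test hK hδ
  exact (test_lower hK.measurableSet h2 ρ).trans ((h φ h1.ct).trans (test_upper Metric.isClosed_cthickening.measurableSet h1.le_one h3 σ))

section
variable {N : ℕ} {s pm r e : ℝ} {p : Euc N → Euc N → ℝ} {rs : ℝ} {q : Euc N → ℝ} {un : ℕ → Euc N → ℝ} {u : Euc N → ℝ}
    {μ ν : Measure (Euc N)} {M : ℝ≥0∞}

lemma CH0.mq (h : CH0 s pm r e p rs q un u μ ν M) {f : Euc N → ℝ} (hf : Measurable f) : Measurable (fun x => |f x| ^ q x) := by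
  have := h.qc.measurable
  fun_prop

lemma CH0.fatouU (h : CH0 s pm r e p rs q un u μ ν M) (hae : ∀ᵐ x, Tendsto (fun n => un n x) atTop (𝓝 (u x))) :
    volume.withDensity (UE s p r u) ≤ μ := by
  have := h.fμ
  have hr := h.r1
  apply le_of_tests
  intro φ hφ
  have hφm := hφ.cont.measurable
  have mU := measurable_UE h.H h.mu
  rw [lintegral_withDensity_eq_lintegral_mul _ mU (by fun_prop)]
  rw [← (h.hμ φ hφ).liminf_eq]
  refine le_trans ?_ (lintegral_liminf_le fun n => Measurable.mul (by fun_prop) (measurable_UE h.H (h.mun n)))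
  apply lintegral_mono_ae
  filter_upwards [hae] with x hx
  have key : UE s p r u x ≤ liminf (fun n => UE s p r (un n) x) atTop := by
    unfold UE
    refine le_trans ?_ (liminf_add_ge _ _)
    gcongr
    · have : Tendsto (fun n => ENNReal.ofReal (|un n x| ^ r)) atTop (𝓝 (ENNReal.ofReal (|u x| ^ r))) :=
        ENNReal.tendsto_ofReal (hx.abs.rpow_const (Or.inr (by linarith)))
      rw [this.liminf_eq]
    · refine le_trans ?_ (lintegral_liminf_le fun n => measurable_sobKernel_right h.H (h.mun n) x)
      apply lintegral_mono_ae
      filter_upwards [hae] with y hy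
      have : Tendsto (fun n => sobKernel s p (un n) x y) atTop (𝓝 (sobKernel s p u x y)) := by
        unfold sobKernel
        refine ENNReal.tendsto_ofReal (Tendsto.div_const ((hx.sub hy).abs.rpow_const (Or.inr ?_)) _)
        have := h.H.lo x y
        have := h.H.hpm
        linarith
      rw [this.liminf_eq]
  have e1 : liminf (fun n => ENNReal.ofReal (φ x) * UE s p r (un n) x) atTop = ENNReal.ofReal (φ x) * liminf (fun n => UE s p r (un n) x) atTop :=
    ENNReal.liminf_const_mul_of_ne_top ENNReal.ofReal_ne_top
  rw [e1, Pi.mul_apply, mul_comm]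
  gcongr

lemma CH0.tq (h : CH0 s pm r e p rs q un u μ ν M) {a : ℕ → ℝ} {b : ℝ} (x : Euc N) (hab : Tendsto a atTop (𝓝 b)) :
    Tendsto (fun n => |a n| ^ q x) atTop (𝓝 (|b| ^ q x)) := by
  refine hab.abs.rpow_const (Or.inr ?_)
  have := h.qlo x
  have := h.H.hpm
  linarith

lemma CH0.fatouV (h : CH0 s pm r e p rs q un u μ ν M) (hae : ∀ᵐ x, Tendsto (fun n => un n x) atTop (𝓝 (u x))) :
    volume.withDensity (fun x => ENNReal.ofReal (|u x| ^ q x)) ≤ ν := by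
  have := h.fν
  apply le_of_tests
  intro φ hφ
  have hφm := hφ.cont.measurable
  rw [lintegral_withDensity_eq_lintegral_mul _ (h.mq h.mu).ennreal_ofReal (by fun_prop)]
  rw [← (h.hν φ hφ).liminf_eq]
  refine le_trans ?_ (lintegral_liminf_le fun n => Measurable.mul (by fun_prop) (h.mq (h.mun n)).ennreal_ofReal)
  apply lintegral_mono_ae
  filter_upwards [hae] with x hx
  have : Tendsto (fun n => ENNReal.ofReal (φ x) * ENNReal.ofReal (|un n x| ^ q x)) atTop (𝓝 (ENNReal.ofReal (φ x) * ENNReal.ofReal (|u x| ^ q x))) :=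
    ENNReal.Tendsto.const_mul (ENNReal.tendsto_ofReal (h.tq x hx)) (Or.inr ENNReal.ofReal_ne_top)
  rw [this.liminf_eq, Pi.mul_apply, mul_comm]

lemma CH0.near (h : CH0 s pm r e p rs q un u μ ν M) {φ : Euc N → ℝ} (hφ : IsTest φ) {η : ℝ} (hη : 0 < η) :
    ∃ E : ℕ → ℝ≥0∞, Tendsto E atTop (𝓝 (ENNReal.ofReal ((1+η)^r) * (ENNReal.ofReal ((1+η)^r) * (∫⁻ x, ENNReal.ofReal (φ x ^ r) ∂μ)
      + ENNReal.ofReal ((1+1/η)^r) * ∫⁻ x, ENNReal.ofReal (φ x ^ r) * UE s p r u x))) ∧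
      ∀ n, ∫⁻ x, Gf s r e (fun y => φ y * (un n y - u y)) x ≤ E n := by
  have hr := h.r1
  obtain ⟨R, hR, hsupp, hE⟩ := near_energy h.H.hN h.H.hs h.H.hs1 h.r1 h.H.he hφ
  obtain ⟨C, hC, hE⟩ := hE η hη
  have hφr := hφ.ct.rpow (show 0 < r by linarith)
  have hφm : Measurable fun x => ENNReal.ofReal (φ x ^ r) := hφr.cont.measurable.ennreal_ofReal
  refine ⟨fun n => ENNReal.ofReal ((1+η)^r) * (ENNReal.ofReal ((1+η)^r) * (∫⁻ x, ENNReal.ofReal (φ x ^ r) * UE s p r (un n) x)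
      + ENNReal.ofReal ((1+1/η)^r) * ∫⁻ x, ENNReal.ofReal (φ x ^ r) * UE s p r u x) + C * ∫⁻ x in Metric.ball 0 R, ENNReal.ofReal (|un n x - u x| ^ r), ?_, ?_⟩
  · have h1 := ENNReal.Tendsto.const_mul (a := ENNReal.ofReal ((1+η)^r)) (h.hμ _ hφr) (Or.inr ENNReal.ofReal_ne_top)
    have h2 := ENNReal.Tendsto.const_mul (a := C) (h.vloc R) (Or.inr hC)
    have h3 := h1.add (tendsto_const_nhds (x := ENNReal.ofReal ((1+1/η)^r) * ∫⁻ x, ENNReal.ofReal (φ x ^ r) * UE s p r u x))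
    have h4 := ENNReal.Tendsto.const_mul (a := ENNReal.ofReal ((1+η)^r)) h3 (Or.inr ENNReal.ofReal_ne_top)
    simpa using h4.add h2
  · intro n
    refine (hE _ (h.mv n)).trans ?_
    refine add_le_add (mul_le_mul_right ?_ _) le_rfl
    have m1 : Measurable fun x => ENNReal.ofReal (φ x ^ r) * UE s p r (un n) x := hφm.mul (measurable_UE h.H (h.mun n))
    have m2 : Measurable fun x => ENNReal.ofReal (φ x ^ r) * UE s p r u x := hφm.mul (measurable_UE h.H h.mu)
    calc ∫⁻ x, ENNReal.ofReal (φ x ^ r) * Gf s r e (fun y => un n y - u y) x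
        ≤ ∫⁻ x, (ENNReal.ofReal ((1+η)^r) * (ENNReal.ofReal (φ x ^ r) * UE s p r (un n) x) + ENNReal.ofReal ((1+1/η)^r) * (ENNReal.ofReal (φ x ^ r) * UE s p r u x)) := by
          refine lintegral_mono fun x => ?_
          refine (mul_le_mul_right (h.Gv hη n x) _).trans (le_of_eq ?_)
          ring
      _ = _ := by
          rw [lintegral_add_left (m1.const_mul _), lintegral_const_mul _ m1, lintegral_const_mul _ m2]

lemma CH0.pw (h : CH0 s pm r e p rs q un u μ ν M) {φ : Euc N → ℝ} (hφ : CT φ) (a : ℝ) (ha : 0 < a)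
    (hT : ∀ R : ℝ, Tendsto (fun n => ∫⁻ x in Metric.ball 0 R, ENNReal.ofReal (|un n x - u x| ^ a)) atTop (𝓝 0)) :
    Tendsto (fun n => ∫⁻ x, ENNReal.ofReal (|φ x * (un n x - u x)| ^ a)) atTop (𝓝 0) := by
  obtain ⟨R, hR, hs⟩ := hφ.supp
  refine tendsto_of_tendsto_of_tendsto_of_le_of_le tendsto_const_nhds (hT R) (fun _ => zero_le) fun n => ?_
  rw [← lintegral_indicator measurableSet_ball]
  refine lintegral_mono fun x => ?_
  by_cases hx : x ∈ Metric.ball 0 R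
  · rw [indicator_of_mem hx]
    apply ENNReal.ofReal_le_ofReal
    apply Real.rpow_le_rpow (abs_nonneg _) _ ha.le
    rw [abs_mul, abs_of_nonneg (hφ.nonneg x)]
    exact mul_le_of_le_one_left (abs_nonneg _) (hφ.le_one x)
  · have : φ x = 0 := by by_contra h; exact hx (hs x h)
    simp [this, Real.zero_rpow ha.ne']

lemma CH0.modb (h : CH0 s pm r e p rs q un u μ ν M) {φ : Euc N → ℝ} (hφ : IsTest φ) {η : ℝ} (hη : 0 < η) {l : ℝ} (hl : 0 < l) :
    ∃ E : ℕ → ℝ≥0∞, Tendsto E atTop (𝓝 (ENNReal.ofReal (l ^ (-r)) * (ENNReal.ofReal ((1+η)^r) * (ENNReal.ofReal ((1+η)^r) * (∫⁻ x, ENNReal.ofReal (φ x ^ r) ∂μ)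
      + ENNReal.ofReal ((1+1/η)^r) * ∫⁻ x, ENNReal.ofReal (φ x ^ r) * UE s p r u x)))) ∧
      ∀ n, sobModular univ s p (fun y => φ y * (un n y - u y) / l) ≤ E n := by
  have hr := h.r1
  have hpm := h.H.hpm
  obtain ⟨E, hE, hE2⟩ := h.near hφ hη
  obtain ⟨C, hC, hF⟩ := far_energy h.H
  have hφm : Measurable φ := hφ.cont.measurable
  refine ⟨fun n => ENNReal.ofReal (l ^ (-r)) * E n + C * (ENNReal.ofReal (l ^ (-pm)) * (∫⁻ x, ENNReal.ofReal (|φ x * (un n x - u x)| ^ pm))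
    + ENNReal.ofReal (l ^ (-r)) * ∫⁻ x, ENNReal.ofReal (|φ x * (un n x - u x)| ^ r)), ?_, ?_⟩
  · have h1 := ENNReal.Tendsto.const_mul (a := ENNReal.ofReal (l ^ (-r))) hE (Or.inr ENNReal.ofReal_ne_top)
    have h2 := ENNReal.Tendsto.const_mul (a := ENNReal.ofReal (l ^ (-pm))) (h.pw hφ.ct pm (by linarith) h.vlocpm) (Or.inr ENNReal.ofReal_ne_top)
    have h3 := ENNReal.Tendsto.const_mul (a := ENNReal.ofReal (l ^ (-r))) (h.pw hφ.ct r (by linarith) h.vloc) (Or.inr ENNReal.ofReal_ne_top)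
    have h4 := ENNReal.Tendsto.const_mul (a := C) (h2.add h3) (Or.inr hC)
    simpa using h1.add h4
  · intro n
    have mf : Measurable fun y => φ y * (un n y - u y) := hφm.mul (h.mv n)
    refine (hF _ (mf.div_const l)).trans ?_
    simp_rw [Gf_div _ hl mf]
    rw [lintegral_const_mul _ (measurable_Gf s r e mf)]
    have h1 : ∀ (a : ℝ) (t : ℝ), ENNReal.ofReal (|t / l| ^ a) = ENNReal.ofReal (l ^ (-a)) * ENNReal.ofReal (|t| ^ a) := by
      intro a t
      rw [← ENNReal.ofReal_mul (by positivity)]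
      congr 1
      rw [abs_div, abs_of_pos hl, Real.div_rpow (abs_nonneg _) hl.le, Real.rpow_neg hl.le]; ring
    simp_rw [h1]
    have mm : ∀ a : ℝ, Measurable fun x => ENNReal.ofReal (|φ x * (un n x - u x)| ^ a) := fun a =>
      (mf.norm.pow_const a).ennreal_ofReal
    rw [lintegral_add_left ((mm pm).const_mul _), lintegral_const_mul _ (mm pm), lintegral_const_mul _ (mm r)]
    gcongr
    exact hE2 n
end

lemma bl_pt {ε Q : ℝ} (hε : 0 < ε) (hQ : 1 ≤ Q) : ∃ C : ℝ, 0 ≤ C ∧ ∀ q, 1 ≤ q → q ≤ Q → ∀ a b : ℝ,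
    |(|a + b| ^ q - |a| ^ q - |b| ^ q)| ≤ ε * |a| ^ q + C * |b| ^ q := by
  have hcont : Tendsto (fun η : ℝ => (1 + η) ^ Q) (𝓝[>] 0) (𝓝 1) := by
    have : ContinuousAt (fun η : ℝ => (1 + η) ^ Q) 0 := by
      apply ContinuousAt.rpow_const (by fun_prop) (Or.inr (by linarith))
    have h := this.tendsto
    simp at h
    exact h.mono_left nhdsWithin_le_nhds
  obtain ⟨η, h1, hη⟩ := ((hcont.eventually (gt_mem_nhds (show (1:ℝ) < 1 + ε by linarith))).and self_mem_nhdsWithin).exists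
  have hη : 0 < η := hη
  have hη' : 0 < 1 + 1/η := by positivity
  refine ⟨(1 + 1/η) ^ Q + 1, by positivity, fun q hq hqQ a b => ?_⟩
  have i1 := abs_add_rpow hη hq hqQ a b
  have i2 := abs_add_rpow hη hq hqQ (a + b) (-b)
  rw [add_neg_cancel_right, abs_neg] at i2
  have hA : 1 ≤ (1 + η) ^ Q := Real.one_le_rpow (by linarith) (by linarith)
  set A := (1 + η) ^ Q
  set B := (1 + 1/η) ^ Q
  have hB : 0 ≤ B := by positivity
  have ha : 0 ≤ |a| ^ q := by positivity
  have hb : 0 ≤ |b| ^ q := by positivity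
  have hab : 0 ≤ |a + b| ^ q := by positivity
  generalize |a| ^ q = x at *
  generalize |b| ^ q = y at *
  generalize |a + b| ^ q = z at *
  rw [abs_le]
  constructor
  · by_cases hzx : z ≤ x
    · have : (A - 1) * z ≤ ε * x := by
        calc (A - 1) * z ≤ (A - 1) * x := by apply mul_le_mul_of_nonneg_left hzx; linarith
          _ ≤ ε * x := by apply mul_le_mul_of_nonneg_right _ ha; linarith
      nlinarith
    · nlinarith [mul_nonneg hε.le ha, mul_nonneg hB hb]
  · have : (A - 1) * x ≤ ε * x := by apply mul_le_mul_of_nonneg_right _ ha; linarith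
    nlinarith

lemma bl_real {a b : ℕ → ℝ} {c A Bd : ℝ} (ha : Tendsto a atTop (𝓝 A)) (hb : ∀ᶠ n in atTop, b n ≤ Bd)
    (h : ∀ ε, 0 < ε → ∃ w : ℕ → ℝ, Tendsto w atTop (𝓝 0) ∧ ∀ᶠ n in atTop, |a n - b n - c| ≤ ε * b n + w n) :
    Tendsto b atTop (𝓝 (A - c)) := by
  have hd : Tendsto (fun n => a n - b n - c) atTop (𝓝 0) := by
    rw [Metric.tendsto_atTop']
    intro δ hδ
    have hB : 0 < |Bd| + 1 := by positivity
    obtain ⟨w, hw, hw2⟩ := h (δ / (2 * (|Bd| + 1))) (by positivity)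
    have h3 := hw.eventually (gt_mem_nhds (show (0:ℝ) < δ/2 by positivity))
    obtain ⟨n0, hn0⟩ := eventually_atTop.1 ((hb.and hw2).and h3)
    refine ⟨n0, fun n hn => ?_⟩
    obtain ⟨⟨g1, g2⟩, g3⟩ := hn0 n hn.le
    rw [Real.dist_eq, sub_zero]
    have : δ / (2 * (|Bd| + 1)) * b n ≤ δ / 2 := by
      calc δ / (2 * (|Bd| + 1)) * b n ≤ δ / (2 * (|Bd| + 1)) * (|Bd| + 1) := by
            gcongr; linarith [le_abs_self Bd]
        _ = δ / 2 := by field_simp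
    linarith
  have := (ha.sub hd).sub (tendsto_const_nhds (x := c))
  simp only [sub_zero] at this
  refine this.congr fun n => by ring

section
variable {N : ℕ} {s pm r e : ℝ} {p : Euc N → Euc N → ℝ} {rs : ℝ} {q : Euc N → ℝ} {un : ℕ → Euc N → ℝ} {u : Euc N → ℝ}
    {μ ν νb : Measure (Euc N)} {M : ℝ≥0∞}

lemma CT.int_fin {φ : Euc N → ℝ} (hφ : CT φ) (σ : Measure (Euc N)) [IsFiniteMeasure σ] : ∫⁻ x, ENNReal.ofReal (φ x) ∂σ < ⊤ := by
  calc ∫⁻ x, ENNReal.ofReal (φ x) ∂σ ≤ ∫⁻ x, 1 ∂σ := lintegral_mono fun x => by simpa using hφ.le_one x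
    _ < ⊤ := by simp

set_option maxHeartbeats 1000000 in
lemma CH0.bl (h : CH0 s pm r e p rs q un u μ ν M) (hae : ∀ᵐ x, Tendsto (fun n => un n x) atTop (𝓝 (u x)))
    (hb : ν = volume.withDensity (fun x => ENNReal.ofReal (|u x| ^ q x)) + νb) {φ : Euc N → ℝ} (hφ : CT φ) :
    Tendsto (fun n => ∫⁻ x, ENNReal.ofReal (φ x) * ENNReal.ofReal (|un n x - u x| ^ q x)) atTop (𝓝 (∫⁻ x, ENNReal.ofReal (φ x) ∂νb)) := by
  have := h.fν
  have hφm := hφ.cont.measurable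
  have hr := h.r1
  have hrs := h.rrs
  have hpm := h.H.hpm
  have hq1 : ∀ x, 1 ≤ q x := fun x => by linarith [h.qlo x]
  have hφ0 := hφ.nonneg
  -- lintegral versions
  have hmul : ∀ (f : Euc N → ℝ) x, ENNReal.ofReal (φ x) * ENNReal.ofReal (|f x| ^ q x) = ENNReal.ofReal (φ x * |f x| ^ q x) :=
    fun f x => (ENNReal.ofReal_mul (hφ0 x)).symm
  have hmeas : ∀ f : Euc N → ℝ, Measurable f → Measurable fun x => φ x * |f x| ^ q x := fun f hf => hφm.mul (h.mq hf)
  have hnn : ∀ (f : Euc N → ℝ) x, 0 ≤ φ x * |f x| ^ q x := fun f x => mul_nonneg (hφ0 x) (by positivity)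
  have hint : ∀ f : Euc N → ℝ, Measurable f → ∫⁻ x, ENNReal.ofReal (φ x) * ENNReal.ofReal (|f x| ^ q x) < ⊤ → Integrable fun x => φ x * |f x| ^ q x := by
    intro f hf hfin
    refine ⟨(hmeas f hf).aestronglyMeasurable, ?_⟩
    rw [hasFiniteIntegral_iff_ofReal (ae_of_all _ (hnn f))]
    simpa only [hmul f] using hfin
  have hsum : ∫⁻ x, ENNReal.ofReal (φ x) ∂ν = (∫⁻ x, ENNReal.ofReal (φ x) * ENNReal.ofReal (|u x| ^ q x)) + ∫⁻ x, ENNReal.ofReal (φ x) ∂νb := by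
    conv_lhs => rw [hb]
    rw [lintegral_add_measure, lintegral_withDensity_eq_lintegral_mul _ (h.mq h.mu).ennreal_ofReal (by fun_prop)]
    congr 1
    refine lintegral_congr fun x => ?_
    rw [Pi.mul_apply, mul_comm]
  have hνfin := hφ.int_fin ν
  have hcfin : ∫⁻ x, ENNReal.ofReal (φ x) * ENNReal.ofReal (|u x| ^ q x) < ⊤ := by
    rw [hsum] at hνfin
    exact (ENNReal.add_lt_top.1 hνfin).1
  have iu := hint u h.mu hcfin
  have hlim := h.hν φ hφ
  have ev : ∀ᶠ n in atTop, Integrable fun x => φ x * |un n x| ^ q x := by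
    filter_upwards [hlim.eventually (gt_mem_nhds hνfin)] with n hn
    exact hint _ (h.mun n) hn
  have hvle : ∀ n x, φ x * |un n x - u x| ^ q x ≤ 2 ^ rs * (φ x * |un n x| ^ q x + φ x * |u x| ^ q x) := by
    intro n x
    have := abs_add_rpow (η := 1) one_pos (hq1 x) (h.qhi x) (un n x) (- u x)
    rw [abs_neg, ← sub_eq_add_neg] at this
    norm_num at this
    have := mul_le_mul_of_nonneg_left this (hφ0 x)
    linarith
  have iv : ∀ n, (Integrable fun x => φ x * |un n x| ^ q x) → Integrable fun x => φ x * |un n x - u x| ^ q x := by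
    intro n hn
    refine ((hn.add iu).const_mul (2 ^ rs)).mono' (hmeas _ (h.mv n)).aestronglyMeasurable (ae_of_all _ fun x => ?_)
    rw [Real.norm_of_nonneg (hnn (fun x => un n x - u x) x)]
    exact hvle n x
  have hA : Tendsto (fun n => ∫ x, φ x * |un n x| ^ q x) atTop (𝓝 (∫⁻ x, ENNReal.ofReal (φ x) ∂ν).toReal) := by
    have := (ENNReal.tendsto_toReal hνfin.ne).comp hlim
    refine this.congr fun n => ?_
    rw [integral_eq_lintegral_of_nonneg_ae (ae_of_all _ (hnn (un n))) (hmeas _ (h.mun n)).aestronglyMeasurable]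
    simp only [Function.comp, hmul]
  have hfinal := bl_real (b := fun n => ∫ x, φ x * |un n x - u x| ^ q x) (c := ∫ x, φ x * |u x| ^ q x)
    (Bd := 2 ^ rs * (((∫⁻ x, ENNReal.ofReal (φ x) ∂ν).toReal + 1) + ∫ x, φ x * |u x| ^ q x)) hA ?_ ?_
  · have e1 : (∫⁻ x, ENNReal.ofReal (φ x) ∂ν).toReal - ∫ x, φ x * |u x| ^ q x = (∫⁻ x, ENNReal.ofReal (φ x) ∂νb).toReal := by
      have hbfin : ∫⁻ x, ENNReal.ofReal (φ x) ∂νb ≠ ⊤ := by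
        rw [hsum] at hνfin
        exact (ENNReal.add_lt_top.1 hνfin).2.ne
      rw [hsum, ENNReal.toReal_add hcfin.ne hbfin, integral_eq_lintegral_of_nonneg_ae (ae_of_all _ (hnn u)) (hmeas _ h.mu).aestronglyMeasurable]
      simp only [hmul]
      ring
    rw [e1] at hfinal
    have hbfin : ∫⁻ x, ENNReal.ofReal (φ x) ∂νb ≠ ⊤ := by
      rw [hsum] at hνfin
      exact (ENNReal.add_lt_top.1 hνfin).2.ne
    have := ENNReal.tendsto_ofReal hfinal
    rw [ENNReal.ofReal_toReal hbfin] at this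
    refine this.congr' ?_
    filter_upwards [ev] with n hn
    rw [ofReal_integral_eq_lintegral_ofReal (iv n hn) (ae_of_all _ (hnn fun x => un n x - u x))]
    exact lintegral_congr fun x => (hmul (fun x => un n x - u x) x).symm
  · filter_upwards [ev, hA.eventually (gt_mem_nhds (lt_add_one _))] with n hn hn2
    calc ∫ x, φ x * |un n x - u x| ^ q x ≤ ∫ x, 2 ^ rs * (φ x * |un n x| ^ q x + φ x * |u x| ^ q x) :=
          integral_mono (iv n hn) ((hn.add iu).const_mul _) (hvle n)
      _ = 2 ^ rs * ((∫ x, φ x * |un n x| ^ q x) + ∫ x, φ x * |u x| ^ q x) := by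
          rw [integral_const_mul, integral_add hn iu]
      _ ≤ _ := by gcongr
  · intro ε hε
    obtain ⟨C, hC0, hC⟩ := bl_pt hε (show 1 ≤ rs by linarith)
    set D : ℕ → Euc N → ℝ := fun n x => |un n x| ^ q x - |un n x - u x| ^ q x - |u x| ^ q x with hD
    have hDb : ∀ n x, |D n x| ≤ ε * |un n x - u x| ^ q x + C * |u x| ^ q x := by
      intro n x
      have := hC (q x) (hq1 x) (h.qhi x) (un n x - u x) (u x)
      rwa [sub_add_cancel] at this
    set W : ℕ → Euc N → ℝ := fun n x => max 0 (|D n x| - ε * |un n x - u x| ^ q x) with hW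
    have mD : ∀ n, Measurable (D n) := fun n => ((h.mq (h.mun n)).sub (h.mq (h.mv n))).sub (h.mq h.mu)
    have mW : ∀ n, Measurable (W n) := fun n => measurable_const.max ((mD n).norm.sub ((h.mq (h.mv n)).const_mul ε))
    have hWb : ∀ n x, φ x * W n x ≤ C * (φ x * |u x| ^ q x) := by
      intro n x
      have h1 : W n x ≤ C * |u x| ^ q x := max_le (by positivity) (by linarith [hDb n x])
      nlinarith [mul_le_mul_of_nonneg_left h1 (hφ0 x)]
    have hW0 : ∀ n x, 0 ≤ φ x * W n x := fun n x => mul_nonneg (hφ0 x) (le_max_left _ _)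
    have iW : ∀ n, Integrable fun x => φ x * W n x := by
      intro n
      refine (iu.const_mul C).mono' (hφm.mul (mW n)).aestronglyMeasurable (ae_of_all _ fun x => ?_)
      rw [Real.norm_of_nonneg (hW0 n x)]; exact hWb n x
    refine ⟨fun n => ∫ x, φ x * W n x, ?_, ?_⟩
    · have : Tendsto (fun n => ∫ x, φ x * W n x) atTop (𝓝 (∫ x : Euc N, (0:ℝ))) := by
        refine tendsto_integral_of_dominated_convergence (fun x => C * (φ x * |u x| ^ q x)) (fun n => (hφm.mul (mW n)).aestronglyMeasurable)
          (iu.const_mul C) (fun n => ae_of_all _ fun x => ?_) ?_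
        · rw [Real.norm_of_nonneg (hW0 n x)]; exact hWb n x
        · filter_upwards [hae] with x hx
          have t1 := h.tq x hx
          have t2 : Tendsto (fun n => un n x - u x) atTop (𝓝 0) := by simpa using hx.sub (tendsto_const_nhds (x := u x))
          have t3 := h.tq x t2
          rw [abs_zero, Real.zero_rpow (by linarith [hq1 x])] at t3
          have t4 : Tendsto (fun n => D n x) atTop (𝓝 0) := by
            simpa using (t1.sub t3).sub (tendsto_const_nhds (x := |u x| ^ q x))
          have t5 := ((t4.abs).sub (t3.const_mul ε))
          have t6 := (tendsto_const_nhds (x := (0:ℝ))).max t5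
          simpa using t6.const_mul (φ x)
      simpa using this
    · filter_upwards [ev] with n hn
      have i2 := iv n hn
      have i3 : Integrable (fun x => φ x * |un n x| ^ q x - φ x * |un n x - u x| ^ q x) := hn.sub i2
      have i4 : Integrable (fun x => ε * (φ x * |un n x - u x| ^ q x)) := i2.const_mul ε
      rw [← integral_sub hn i2, ← integral_sub i3 iu, ← integral_const_mul, ← integral_add i4 (iW n), ← Real.norm_eq_abs]
      refine (norm_integral_le_integral_norm _).trans ?_
      refine integral_mono (i3.sub iu).norm (i4.add (iW n)) fun x => ?_
      have e1 : φ x * |un n x| ^ q x - φ x * |un n x - u x| ^ q x - φ x * |u x| ^ q x = φ x * D n x := by rw [hD]; ring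
      simp only [e1, norm_mul, Real.norm_eq_abs, abs_of_nonneg (hφ0 x)]
      have h1 : |D n x| - ε * |un n x - u x| ^ q x ≤ W n x := le_max_right _ _
      nlinarith [mul_le_mul_of_nonneg_left h1 (hφ0 x)]
end

section
variable {N : ℕ} {s pm r e : ℝ} {p : Euc N → Euc N → ℝ} {rs : ℝ} {q : Euc N → ℝ} {un : ℕ → Euc N → ℝ} {u : Euc N → ℝ}
  {μ ν νb : Measure (Euc N)} {M : ℝ≥0∞}

lemma CH0.UEle (h : CH0 s pm r e p rs q un u μ ν M) (hae : ∀ᵐ x, Tendsto (fun n => un n x) atTop (𝓝 (u x)))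
    {φ : Euc N → ℝ} (hφ : CT φ) : ∫⁻ x, ENNReal.ofReal (φ x) * UE s p r u x ≤ ∫⁻ x, ENNReal.ofReal (φ x) ∂μ := by
  have hφm := hφ.cont.measurable
  have h1 : ∫⁻ x, ENNReal.ofReal (φ x) * UE s p r u x = ∫⁻ x, ENNReal.ofReal (φ x) ∂(volume.withDensity (UE s p r u)) := by
    rw [lintegral_withDensity_eq_lintegral_mul _ (measurable_UE h.H h.mu) (by fun_prop)]
    refine lintegral_congr fun x => ?_
    simp [mul_comm]
  rw [h1]
  exact lintegral_mono' (h.fatouU hae) le_rfl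

lemma CH0.phiq (h : CH0 s pm r e p rs q un u μ ν M) {φ : Euc N → ℝ} (hφ : IsTest φ) (x : Euc N) (t : ℝ) :
    φ x ^ rs * |t| ^ q x ≤ |φ x * t| ^ q x := by
  have := h.r1
  have := h.rrs
  have hφ0 := hφ.nonneg x
  rw [abs_mul, Real.mul_rpow (abs_nonneg _) (abs_nonneg _), abs_of_nonneg hφ0]
  refine mul_le_mul_of_nonneg_right ?_ (by positivity)
  rcases hφ0.eq_or_lt with h0 | h0
  · rw [← h0, Real.zero_rpow (by linarith)]; positivity
  · exact Real.rpow_le_rpow_of_exponent_ge h0 (hφ.le_one x) (h.qhi x)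

lemma CH0.revH (h : CH0 s pm r e p rs q un u μ ν M) (hae : ∀ᵐ x, Tendsto (fun n => un n x) atTop (𝓝 (u x)))
    [IsFiniteMeasure νb] (hb : ν = volume.withDensity (fun x => ENNReal.ofReal (|u x| ^ q x)) + νb) :
    ∃ C : ℝ≥0∞, C ≠ ⊤ ∧ ∀ φ : Euc N → ℝ, IsTest φ → ∀ α β : ℝ, 0 ≤ α → 0 ≤ β →
      (∀ x, φ x ≠ 0 → ∀ t : ℝ, 0 ≤ t → t ^ q x ≤ α * t ^ rs + β * t ^ pm) →
      ∫⁻ x, ENNReal.ofReal (φ x ^ rs) ∂νb ≤ ENNReal.ofReal α * (C * (∫⁻ x, ENNReal.ofReal (φ x ^ r) ∂μ) ^ (rs / r)) := by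
  have hr := h.r1
  have hrs := h.rrs
  have hpm := h.H.hpm
  have hκ : 0 < rs / r := by apply div_pos <;> linarith
  obtain ⟨C, hC, hC0, hS⟩ := sobolev_ineq h.H.hN h.H.hs h.r1 h.H.hsr h.hrs h.H.he
  set A := ENNReal.ofReal ((1+1:ℝ)^r) with hA
  have hAt : A ≠ ⊤ := ENNReal.ofReal_ne_top
  refine ⟨C * (A * (A + A)) ^ (rs / r), ?_, ?_⟩
  · refine ENNReal.mul_ne_top hC (ENNReal.rpow_ne_top_of_nonneg hκ.le (ENNReal.mul_ne_top hAt (ENNReal.add_ne_top.2 ⟨hAt, hAt⟩)))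
  intro φ hφ α β hα hβ hαβ
  obtain ⟨E, hE, hE2⟩ := h.near hφ one_pos
  have hφrs := hφ.ct.rpow (show 0 < rs by linarith)
  have hφr := hφ.ct.rpow (show 0 < r by linarith)
  have hY := h.UEle hae hφr
  set X := ∫⁻ x, ENNReal.ofReal (φ x ^ r) ∂μ
  set Y := ∫⁻ x, ENNReal.ofReal (φ x ^ r) * UE s p r u x
  have hφm : Measurable φ := hφ.ct.cont.measurable
  have hb1 := h.bl hae hb hφrs
  have hp0 := h.pw hφ.ct pm (by linarith) h.vlocpm
  have hle : ∀ n, ∫⁻ x, ENNReal.ofReal (φ x ^ rs) * ENNReal.ofReal (|un n x - u x| ^ q x) ≤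
      ENNReal.ofReal α * (C * (E n) ^ (rs / r)) + ENNReal.ofReal β * ∫⁻ x, ENNReal.ofReal (|φ x * (un n x - u x)| ^ pm) := by
    intro n
    have mv : Measurable fun x => φ x * (un n x - u x) := hφm.mul (h.mv n)
    have m1 : Measurable fun x => ENNReal.ofReal (|φ x * (un n x - u x)| ^ rs) := by fun_prop
    have m2 : Measurable fun x => ENNReal.ofReal (|φ x * (un n x - u x)| ^ pm) := by fun_prop
    have m3 : Measurable fun x => ENNReal.ofReal α * ENNReal.ofReal (|φ x * (un n x - u x)| ^ rs) := by fun_prop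
    calc _ ≤ ∫⁻ x, (ENNReal.ofReal α * ENNReal.ofReal (|φ x * (un n x - u x)| ^ rs) + ENNReal.ofReal β * ENNReal.ofReal (|φ x * (un n x - u x)| ^ pm)) := by
          refine lintegral_mono fun x => ?_
          rw [← ENNReal.ofReal_mul (Real.rpow_nonneg (hφ.nonneg x) _), ← ENNReal.ofReal_mul hα, ← ENNReal.ofReal_mul hβ, ← ENNReal.ofReal_add (by positivity) (by positivity)]
          apply ENNReal.ofReal_le_ofReal
          by_cases hx : φ x = 0
          · rw [hx, Real.zero_rpow (by linarith)]; simp only [zero_mul]; positivity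
          · exact (h.phiq hφ x _).trans (hαβ x hx _ (abs_nonneg _))
      _ = ENNReal.ofReal α * (∫⁻ x, ENNReal.ofReal (|φ x * (un n x - u x)| ^ rs)) + ENNReal.ofReal β * ∫⁻ x, ENNReal.ofReal (|φ x * (un n x - u x)| ^ pm) := by
          rw [lintegral_add_left m3, lintegral_const_mul _ m1, lintegral_const_mul _ m2]
      _ ≤ _ := by
          gcongr
          refine (hS _ mv).trans ?_
          gcongr
          exact hE2 n
  have hlim : Tendsto (fun n => ENNReal.ofReal α * (C * (E n) ^ (rs / r)) + ENNReal.ofReal β * ∫⁻ x, ENNReal.ofReal (|φ x * (un n x - u x)| ^ pm)) atTop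
      (𝓝 (ENNReal.ofReal α * (C * (A * (A * X + ENNReal.ofReal ((1+1/1:ℝ)^r) * Y)) ^ (rs / r)) + ENNReal.ofReal β * 0)) := by
    refine Tendsto.add ?_ ?_
    · refine ENNReal.Tendsto.const_mul (ENNReal.Tendsto.const_mul ?_ (Or.inr hC)) (Or.inr ENNReal.ofReal_ne_top)
      exact ((ENNReal.continuous_rpow_const (y := rs / r)).tendsto _).comp hE
    · exact ENNReal.Tendsto.const_mul hp0 (Or.inr ENNReal.ofReal_ne_top)
  refine (le_of_tendsto_of_tendsto' hb1 hlim hle).trans ?_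
  rw [mul_zero, add_zero, mul_assoc C, ← ENNReal.mul_rpow_of_nonneg _ _ hκ.le]
  have hle2 : A * (A * X + ENNReal.ofReal ((1+1/1:ℝ)^r) * Y) ≤ A * (A + A) * X := by
    rw [div_one, ← hA, mul_assoc, add_mul]
    gcongr
  gcongr

lemma CH0.L9 (h : CH0 s pm r e p rs q un u μ ν M) (hae : ∀ᵐ x, Tendsto (fun n => un n x) atTop (𝓝 (u x)))
    [IsFiniteMeasure νb] (hb : ν = volume.withDensity (fun x => ENNReal.ofReal (|u x| ^ q x)) + νb) :
    ∃ C : ℝ≥0∞, C ≠ ⊤ ∧ ∀ K : Set (Euc N), IsCompact K → ∀ (d α β : ℝ), 0 < d → 0 ≤ α → 0 ≤ β → 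
      (∀ x ∈ Metric.cthickening d K, ∀ t : ℝ, 0 ≤ t → t ^ q x ≤ α * t ^ rs + β * t ^ pm) →
      νb K ≤ ENNReal.ofReal α * (C * μ K ^ (rs / r)) := by
  have := h.fμ
  have hr := h.r1
  have hrs := h.rrs
  have hκ : 0 < rs / r := by apply div_pos <;> linarith
  obtain ⟨C, hC, hH⟩ := h.revH hae hb
  refine ⟨C, hC, fun K hK d α β hd hα hβ hαβ => ?_⟩
  have ht := (tendsto_measure_cthickening_of_isCompact (μ := μ) hK).mono_left (nhdsWithin_le_nhds (s := Ioi 0))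
  have ht2 : Tendsto (fun δ => ENNReal.ofReal α * (C * μ (Metric.cthickening δ K) ^ (rs / r))) (𝓝[>] 0) (𝓝 (ENNReal.ofReal α * (C * μ K ^ (rs / r)))) := by
    refine ENNReal.Tendsto.const_mul (ENNReal.Tendsto.const_mul ?_ (Or.inr hC)) (Or.inr ENNReal.ofReal_ne_top)
    exact ((ENNReal.continuous_rpow_const (y := rs / r)).tendsto _).comp ht
  refine ge_of_tendsto ht2 ?_
  filter_upwards [Ioo_mem_nhdsGT hd] with δ hδ
  obtain ⟨φ, h1, h2, h3⟩ := exists_test hK hδ.1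
  have hφrs := h1.ct.rpow (show 0 < rs by linarith)
  have hφr := h1.ct.rpow (show 0 < r by linarith)
  refine (test_lower hK.measurableSet (φ := fun x => φ x ^ rs) (fun x hx => by simp [h2 x hx]) νb).trans ?_
  refine (hH φ h1 α β hα hβ fun x hx => hαβ x (Metric.cthickening_mono hδ.2.le _ (h3 x hx))).trans ?_
  gcongr
  refine test_upper Metric.isClosed_cthickening.measurableSet hφr.le_one (fun x hx => h3 x ?_) μ
  intro h0; apply hx; simp only [h0]; exact Real.zero_rpow (by linarith)

lemma CH0.atoms (h : CH0 s pm r e p rs q un u μ ν M) (hae : ∀ᵐ x, Tendsto (fun n => un n x) atTop (𝓝 (u x)))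
    [IsFiniteMeasure νb] (hb : ν = volume.withDensity (fun x => ENNReal.ofReal (|u x| ^ q x)) + νb) :
    νb {x | νb {x} = 0} = 0 ∧ (∀ x, νb {x} ≠ 0 → μ {x} ≠ 0) ∧ ∀ x, νb {x} ≠ 0 → q x = rs := by
  have := h.fμ
  have hr := h.r1
  have hrs := h.rrs
  have hpm := h.H.hpm
  have hκ : 1 < rs / r := by rw [lt_div_iff₀ (by linarith)]; linarith
  obtain ⟨C, hC, hH⟩ := h.L9 hae hb
  have hK : ∀ K, IsCompact K → νb K ≤ C * μ K ^ (rs / r) := by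
    intro K hK
    have := hH K hK 1 1 1 one_pos zero_le_one zero_le_one fun x _ t ht => by
      rw [one_mul, one_mul, add_comm]
      exact rpow_le_two ht (by linarith) (h.qlo x) (h.qhi x)
    simpa using this
  have ha := atomic hC hκ hK
  have h2 : ∀ x, νb {x} ≠ 0 → μ {x} ≠ 0 := by
    intro x hx h0
    have := hK {x} isCompact_singleton
    rw [h0, ENNReal.zero_rpow_of_pos (by linarith), mul_zero] at this
    exact hx (le_antisymm this zero_le)
  refine ⟨?_, h2, ?_⟩
  · have hc := atoms_countable μ
    have h3 : νb ({x | νb {x} = 0} ∩ {x | μ {x} ≠ 0}) = 0 := by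
      rw [← Measure.restrict_apply_self] 
      rw [Measure.restrict_apply_self]
      have hc2 : ({x | νb {x} = 0} ∩ {x | μ {x} ≠ 0}).Countable := hc.mono inter_subset_right
      rw [← biUnion_of_singleton ({x | νb {x} = 0} ∩ {x | μ {x} ≠ 0}), measure_biUnion_null_iff hc2]
      exact fun x hx => hx.1
    refine measure_mono_null (t := ({x | νb {x} = 0} ∩ {x | μ {x} ≠ 0}) ∪ {x | μ {x} = 0}) ?_ (measure_union_null h3 ha)
    intro x hx
    by_cases hμx : μ {x} = 0
    · exact Or.inr hμx
    · exact Or.inl ⟨hx, hμx⟩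
  · intro x0 hx0
    by_contra hne
    have hlt : q x0 < rs := lt_of_le_of_ne (h.qhi x0) hne
    obtain ⟨q1, hq1, hq2⟩ := exists_between hlt
    have hev : ∀ᶠ x in 𝓝 x0, q x < q1 := h.qc.continuousAt.eventually_lt_const hq1
    obtain ⟨d, hd, hball⟩ := Metric.nhds_basis_closedBall.eventually_iff.1 hev
    have hT : ∀ T : ℝ, 1 ≤ T → νb {x0} ≤ ENNReal.ofReal (T ^ (q1 - rs)) * (C * μ {x0} ^ (rs / r)) := by
      intro T hT
      refine hH {x0} isCompact_singleton d (T ^ (q1 - rs)) (T ^ (rs - pm)) hd (by positivity) (by positivity) fun x hx t ht => ?_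
      rw [Metric.cthickening_singleton _ hd.le] at hx
      have hqx := hball hx
      have hqp := h.qlo x
      rcases ht.eq_or_lt with h0 | ht
      · rw [← h0, Real.zero_rpow (by linarith)]; positivity
      rcases le_total T t with htT | htT
      · have h1 : t ^ q x ≤ T ^ (q1 - rs) * t ^ rs := by
          calc t ^ q x ≤ t ^ q1 := Real.rpow_le_rpow_of_exponent_le (by linarith) hqx.le
            _ = t ^ (q1 - rs) * t ^ rs := by rw [← Real.rpow_add ht]; ring_nf
            _ ≤ _ := by
              refine mul_le_mul_of_nonneg_right ?_ (by positivity)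
              exact Real.rpow_le_rpow_of_nonpos (by linarith : 0 < T) htT (by linarith)
        have : 0 ≤ T ^ (rs - pm) * t ^ pm := by positivity
        linarith
      · have h1 : t ^ q x ≤ T ^ (rs - pm) * t ^ pm := by
          calc t ^ q x = t ^ (q x - pm) * t ^ pm := by rw [← Real.rpow_add ht]; ring_nf
            _ ≤ T ^ (q x - pm) * t ^ pm := mul_le_mul_of_nonneg_right (Real.rpow_le_rpow ht.le htT (by linarith)) (by positivity)
            _ ≤ _ := by gcongr; exact h.qhi x
        have : 0 ≤ T ^ (q1 - rs) * t ^ rs := by positivity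
        linarith
    have hfin : C * μ {x0} ^ (rs / r) ≠ ⊤ := ENNReal.mul_ne_top hC (ENNReal.rpow_ne_top_of_nonneg (by linarith) (measure_ne_top _ _))
    have hl : Tendsto (fun T : ℝ => ENNReal.ofReal (T ^ (q1 - rs)) * (C * μ {x0} ^ (rs / r))) atTop (𝓝 (ENNReal.ofReal 0 * (C * μ {x0} ^ (rs / r)))) := by
      refine ENNReal.Tendsto.mul_const ?_ (Or.inr hfin)
      refine (ENNReal.continuous_ofReal.tendsto _).comp ?_
      have := tendsto_rpow_neg_atTop (y := rs - q1) (by linarith)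
      simpa using this
    have := ge_of_tendsto hl (by filter_upwards [eventually_ge_atTop 1] with T hT' using hT T hT')
    simp only [ENNReal.ofReal_zero, zero_mul] at this
    exact hx0 (le_antisymm this zero_le)
end

lemma sq_le_of {N : ℕ} {s l L : ℝ} {p : Euc N → Euc N → ℝ} {q : Euc N → ℝ} {f : Euc N → ℝ}
    (hl : 0 < l) (hL : 0 < L) (hf : MemSob univ s p f) (hq : ∀ x, 0 < q x)
    (h1 : sobModular univ s p (fun x => f x / l) ≤ 1)
    (h2 : ∀ c, 0 < c → c ≤ L → 1 < varModular volume q (fun x => f x / c)) : Sq s p q ≤ l / L := by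
  have h3 : sobNorm univ s p f ≤ l := csInf_le ⟨0, fun c hc => hc.1.le⟩ ⟨hl, h1⟩
  have hS0 : 0 ≤ sobNorm univ s p f := Real.sInf_nonneg fun c hc => hc.1.le
  have hne : ¬ f =ᵐ[volume] 0 := by
    intro h0
    have := h2 L hL le_rfl
    have h4 : varModular volume q (fun x => f x / L) = 0 := by
      unfold varModular
      rw [← lintegral_zero (μ := (volume : Measure (Euc N)))]
      apply lintegral_congr_ae
      filter_upwards [h0] with x hx
      rw [hx]; simp [Real.zero_rpow (hq x).ne']
    rw [h4] at this; simp at this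
  have h5 : Sq s p q ≤ sobNorm univ s p f / luxNorm volume q f := by
    refine csInf_le ⟨0, ?_⟩ ⟨f, hf, hne, rfl⟩
    rintro c ⟨g, -, -, rfl⟩
    exact div_nonneg (Real.sInf_nonneg fun c hc => hc.1.le) (Real.sInf_nonneg fun c hc => hc.1.le)
  refine h5.trans ?_
  by_cases hem : ({c : ℝ | 0 < c ∧ varModular volume q (fun x => f x / c) ≤ 1}).Nonempty
  · have h6 : L ≤ luxNorm volume q f := by
      refine le_csInf hem fun c hc => ?_
      by_contra hlt
      exact absurd hc.2 (not_le.2 (h2 c hc.1 (not_le.1 hlt).le))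
    gcongr
  · have : luxNorm volume q f = 0 := by
      unfold luxNorm; rw [not_nonempty_iff_eq_empty.1 hem]; exact Real.sInf_empty
    rw [this, div_zero]; positivity

section
variable {N : ℕ} {s pm r e : ℝ} {p : Euc N → Euc N → ℝ} {rs : ℝ} {q : Euc N → ℝ} {un : ℕ → Euc N → ℝ} {u : Euc N → ℝ}
  {μ ν νb : Measure (Euc N)} {M : ℝ≥0∞}

lemma CH0.sq1 (h : CH0 s pm r e p rs q un u μ ν M) (hae : ∀ᵐ x, Tendsto (fun n => un n x) atTop (𝓝 (u x)))
    [IsFiniteMeasure νb] (hb : ν = volume.withDensity (fun x => ENNReal.ofReal (|u x| ^ q x)) + νb)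
    {x0 : Euc N} (hx0 : q x0 = rs) {l L : ℝ} (hl : 0 < l) (hL : 0 < L)
    (hlm : μ {x0} < ENNReal.ofReal (l ^ r)) (hLw : ENNReal.ofReal (L ^ rs) < νb {x0}) : Sq s p q ≤ l / L := by
  have := h.fμ
  have hr := h.r1
  have hrs := h.rrs
  have hpm := h.H.hpm
  have hN : 0 < N := h.H.hN
  have mU := measurable_UE h.H h.mu
  set ρ := volume.withDensity (UE s p r u) with hρ
  have hρμ : ρ ≤ μ := h.fatouU hae
  have : IsFiniteMeasure ρ := ⟨(hρμ univ).trans_lt (measure_lt_top μ univ)⟩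
  have hne : Nonempty (Fin N) := ⟨⟨0, hN⟩⟩
  have hρ0 : ρ {x0} = 0 := by
    rw [hρ]; exact withDensity_absolutelyContinuous _ _ (by simp)
  have hlr : 0 < l ^ r := by positivity
  -- choice of eta
  have hη : ∃ η : ℝ, 0 < η ∧ ENNReal.ofReal ((1+η)^r) * (ENNReal.ofReal ((1+η)^r) * μ {x0}) < ENNReal.ofReal (l ^ r) := by
    have hc : ContinuousAt (fun η : ℝ => (1+η)^r) 0 := by
      refine ContinuousAt.rpow_const (by fun_prop) (Or.inr (by linarith))
    have t0 : Tendsto (fun η : ℝ => (1+η)^r) (𝓝[>] 0) (𝓝 1) := by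
      have := hc.tendsto.mono_left (nhdsWithin_le_nhds (s := Ioi 0)); simpa using this
    have t1 : Tendsto (fun η : ℝ => ENNReal.ofReal ((1+η)^r)) (𝓝[>] 0) (𝓝 1) := by
      have := (ENNReal.continuous_ofReal.tendsto _).comp t0; rw [ENNReal.ofReal_one] at this; exact this
    have t2 : Tendsto (fun η : ℝ => ENNReal.ofReal ((1+η)^r) * (ENNReal.ofReal ((1+η)^r) * μ {x0})) (𝓝[>] 0) (𝓝 (1 * (1 * μ {x0}))) :=
      ENNReal.Tendsto.mul t1 (Or.inl one_ne_zero) (ENNReal.Tendsto.mul_const t1 (Or.inr (measure_ne_top _ _))) (Or.inr ENNReal.one_ne_top)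
    rw [one_mul, one_mul] at t2
    obtain ⟨η, h1, h2⟩ := ((t2.eventually_lt_const hlm).and self_mem_nhdsWithin).exists
    exact ⟨η, h2, h1⟩
  obtain ⟨η, hη0, hη⟩ := hη
  set A := ENNReal.ofReal ((1+η)^r) with hA
  set B := ENNReal.ofReal ((1+1/η)^r) with hB
  -- choice of c
  have hc : ∃ c : ℝ, 0 < c ∧ c < L ^ (-rs) ∧ 1 < ENNReal.ofReal c * νb {x0} := by
    have hw : 1 < ENNReal.ofReal (L ^ (-rs)) * νb {x0} := by
      have : (1 : ℝ≥0∞) = ENNReal.ofReal (L ^ (-rs)) * ENNReal.ofReal (L ^ rs) := by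
        rw [← ENNReal.ofReal_mul (by positivity), ← Real.rpow_add hL]; simp
      rw [this]
      exact ENNReal.mul_lt_mul_right (by simpa using by positivity) ENNReal.ofReal_ne_top hLw
    have t : Tendsto (fun c : ℝ => ENNReal.ofReal c * νb {x0}) (𝓝[<] (L ^ (-rs))) (𝓝 (ENNReal.ofReal (L ^ (-rs)) * νb {x0})) :=
      ENNReal.Tendsto.mul_const ((ENNReal.continuous_ofReal.tendsto _).mono_left nhdsWithin_le_nhds) (Or.inr (measure_ne_top _ _))
    have hp : 0 < L ^ (-rs) := by positivity
    obtain ⟨c, h1, h2⟩ := ((t.eventually_const_lt hw).and (Ioo_mem_nhdsLT hp)).exists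
    exact ⟨c, h2.1, h2.2, h1⟩
  obtain ⟨c, hc0, hc1, hcw⟩ := hc
  -- choice of delta
  have hev : ∀ᶠ x in 𝓝 x0, c < L ^ (- q x) := by
    have hcon : Continuous fun x => L ^ (- q x) := by
      have := h.qc
      exact Continuous.rpow continuous_const this.neg (fun x => Or.inl hL.ne')
    refine hcon.continuousAt.eventually_const_lt ?_
    simp only [hx0]; exact hc1
  obtain ⟨d, hd, hball⟩ := Metric.nhds_basis_closedBall.eventually_iff.1 hev
  have hδ : ∃ δ : ℝ, 0 < δ ∧ δ < d ∧ A * (A * μ (Metric.cthickening δ {x0}) + B * ρ (Metric.cthickening δ {x0})) < ENNReal.ofReal (l ^ r) := by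
    have t1 := (tendsto_measure_cthickening_of_isCompact (μ := μ) (isCompact_singleton (x := x0))).mono_left (nhdsWithin_le_nhds (s := Ioi 0))
    have t2 := (tendsto_measure_cthickening_of_isCompact (μ := ρ) (isCompact_singleton (x := x0))).mono_left (nhdsWithin_le_nhds (s := Ioi 0))
    have t3 : Tendsto (fun δ => A * (A * μ (Metric.cthickening δ {x0}) + B * ρ (Metric.cthickening δ {x0}))) (𝓝[>] 0) (𝓝 (A * (A * μ {x0} + B * ρ {x0}))) :=
      ENNReal.Tendsto.const_mul ((ENNReal.Tendsto.const_mul t1 (Or.inr ENNReal.ofReal_ne_top)).add (ENNReal.Tendsto.const_mul t2 (Or.inr ENNReal.ofReal_ne_top))) (Or.inr ENNReal.ofReal_ne_top)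
    rw [hρ0, mul_zero, add_zero] at t3
    obtain ⟨δ, h1, h2⟩ := ((t3.eventually_lt_const hη).and (Ioo_mem_nhdsGT hd)).exists
    exact ⟨δ, h2.1, h2.2, h1⟩
  obtain ⟨δ, hδ0, hδd, hδ⟩ := hδ
  obtain ⟨φ, h1, h2, h3⟩ := exists_test (isCompact_singleton (x := x0)) hδ0
  have hφrs := h1.ct.rpow (show 0 < rs by linarith)
  have hφr := h1.ct.rpow (show 0 < r by linarith)
  have hφm : Measurable φ := h1.ct.cont.measurable
  have hsupp : ∀ x, φ x ^ r ≠ 0 → x ∈ Metric.cthickening δ {x0} := by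
    intro x hx; apply h3
    intro h0; apply hx; simp only [h0]; exact Real.zero_rpow (by linarith)
  obtain ⟨E, hE, hE2⟩ := h.modb h1 hη0 hl
  have hX := test_upper Metric.isClosed_cthickening.measurableSet hφr.le_one hsupp μ
  have hY : ∫⁻ x, ENNReal.ofReal (φ x ^ r) * UE s p r u x ≤ ρ (Metric.cthickening δ {x0}) := by
    refine le_trans (le_of_eq ?_) (test_upper Metric.isClosed_cthickening.measurableSet hφr.le_one hsupp ρ)
    rw [hρ, lintegral_withDensity_eq_lintegral_mul _ mU (by fun_prop)]
    refine lintegral_congr fun x => ?_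
    simp [mul_comm]
  have hlim : ENNReal.ofReal (l ^ (-r)) * (A * (A * (∫⁻ x, ENNReal.ofReal (φ x ^ r) ∂μ) + B * ∫⁻ x, ENNReal.ofReal (φ x ^ r) * UE s p r u x)) < 1 := by
    have : (1 : ℝ≥0∞) = ENNReal.ofReal (l ^ (-r)) * ENNReal.ofReal (l ^ r) := by
      rw [← ENNReal.ofReal_mul (by positivity), ← Real.rpow_add hl]; simp
    rw [this]
    refine ENNReal.mul_lt_mul_right (by simpa using by positivity) ENNReal.ofReal_ne_top (lt_of_le_of_lt ?_ hδ)
    gcongr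
  have hb1 := h.bl hae hb hφrs
  have hb2 := ENNReal.Tendsto.const_mul (a := ENNReal.ofReal c) hb1 (Or.inr ENNReal.ofReal_ne_top)
  have hb3 : 1 < ENNReal.ofReal c * ∫⁻ x, ENNReal.ofReal (φ x ^ rs) ∂νb := by
    refine hcw.trans_le ?_
    gcongr
    exact test_lower (measurableSet_singleton x0) (φ := fun x => φ x ^ rs) (fun x hx => by simp [h2 x hx]) νb
  obtain ⟨n, hn1, hn2⟩ := ((hE.eventually_lt_const hlim).and (hb2.eventually_const_lt hb3)).exists
  have hmod : sobModular univ s p (fun y => φ y * (un n y - u y) / l) ≤ 1 := (hE2 n).trans hn1.le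
  have mf : Measurable fun y => φ y * (un n y - u y) := hφm.mul (h.mv n)
  have hmem : MemSob univ s p (fun y => φ y * (un n y - u y)) := by
    refine ⟨mf.aestronglyMeasurable, (mod_mul h.H _ hl (le_max_right 1 l) (le_max_left 1 l)).trans_lt ?_⟩
    exact ENNReal.mul_lt_top ENNReal.ofReal_lt_top (hmod.trans_lt ENNReal.one_lt_top)
  refine sq_le_of hl hL hmem (fun x => by linarith [h.qlo x]) hmod fun c' hc' hcL => ?_
  refine hn2.trans_le ?_
  have mm : Measurable fun x => ENNReal.ofReal (φ x ^ rs) * ENNReal.ofReal (|un n x - u x| ^ q x) :=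
    hφrs.cont.measurable.ennreal_ofReal.mul (h.mq (h.mv n)).ennreal_ofReal
  rw [← lintegral_const_mul _ mm]
  refine lintegral_mono fun x => ?_
  rw [← ENNReal.ofReal_mul (hφrs.nonneg x), ← ENNReal.ofReal_mul hc0.le]
  apply ENNReal.ofReal_le_ofReal
  by_cases hx : φ x = 0
  · rw [hx, Real.zero_rpow (by linarith)]; simp only [zero_mul, mul_zero]; positivity
  have hxb := hball (by
    have := Metric.cthickening_mono hδd.le _ (h3 x hx)
    rwa [Metric.cthickening_singleton _ hd.le] at this)
  have hqx : 0 ≤ q x := by linarith [h.qlo x]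
  rw [abs_div, abs_of_pos hc', Real.div_rpow (abs_nonneg _) hc'.le, div_eq_mul_inv, ← Real.rpow_neg hc'.le, mul_comm]
  refine mul_le_mul (h.phiq h1 x _) (hxb.le.trans ?_) hc0.le (by positivity)
  exact Real.rpow_le_rpow_of_nonpos hc' hcL (by linarith)

lemma CH0.sq2 (h : CH0 s pm r e p rs q un u μ ν M) (hae : ∀ᵐ x, Tendsto (fun n => un n x) atTop (𝓝 (u x)))
    [IsFiniteMeasure νb] (hb : ν = volume.withDensity (fun x => ENNReal.ofReal (|u x| ^ q x)) + νb)
    {x0 : Euc N} (hx0 : q x0 = rs) :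
    Sq s p q * (νb {x0}).toReal ^ (1 / rs) ≤ (μ {x0}).toReal ^ (1 / r) := by
  have := h.fμ
  have hr := h.r1
  have hrs := h.rrs
  set m := (μ {x0}).toReal with hm
  set w := (νb {x0}).toReal with hw
  have hm0 : 0 ≤ m := ENNReal.toReal_nonneg
  have hw0 : 0 ≤ w := ENNReal.toReal_nonneg
  refine le_of_forall_gt_imp_ge_of_dense fun l hl => ?_
  have hl0 : 0 < l := lt_of_le_of_lt (by positivity) hl
  rcases le_or_gt (Sq s p q) 0 with h0 | h0
  · have : 0 ≤ w ^ (1/rs) := by positivity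
    nlinarith
  rw [mul_comm, ← le_div_iff₀ h0]
  refine le_of_forall_lt_imp_le_of_dense fun L hL => ?_
  rcases le_or_gt L 0 with hL0 | hL0
  · exact hL0.trans (by positivity)
  have key := h.sq1 hae hb hx0 hl0 hL0 ?_ ?_
  · rw [le_div_iff₀ hL0] at key
    rw [le_div_iff₀ h0]; linarith
  · rw [← ENNReal.ofReal_toReal (measure_ne_top μ {x0}), ENNReal.ofReal_lt_ofReal_iff (by positivity), ← hm]
    have := Real.rpow_lt_rpow (by positivity) hl (show 0 < r by linarith)
    rwa [← Real.rpow_mul hm0, one_div_mul_cancel (by linarith), Real.rpow_one] at this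
  · rw [← ENNReal.ofReal_toReal (measure_ne_top νb {x0}), ← hw]
    have := Real.rpow_lt_rpow hL0.le hL (show 0 < rs by linarith)
    rw [← Real.rpow_mul hw0, one_div_mul_cancel (by linarith), Real.rpow_one] at this
    rw [ENNReal.ofReal_lt_ofReal_iff (lt_of_le_of_lt (by positivity) this)]
    exact this
end

lemma sum_atoms {N : ℕ} (σ : Measure (Euc N)) [IsFiniteMeasure σ] {A : Set (Euc N)} {I : Set ℕ} {xi : ℕ → Euc N}
    (hinj : ∀ i ∈ I, ∀ j ∈ I, i ≠ j → xi i ≠ xi j) (hA : xi '' I = A) :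
    Measure.sum (fun i : I => ENNReal.ofReal (σ {xi i.1}).toReal • Measure.dirac (xi i.1)) = σ.restrict A := by
  have h1 : A = ⋃ i : I, {xi i.1} := by
    rw [← hA]; ext x; simp [eq_comm]
  rw [h1, Measure.restrict_iUnion]
  · congr 1; ext1 i
    rw [Measure.restrict_singleton, ENNReal.ofReal_toReal (measure_ne_top _ _)]
  · intro i j hij
    rw [Function.onFun, disjoint_singleton]
    exact hinj _ i.2 _ j.2 (fun h => hij (Subtype.ext h))
  · exact fun i => measurableSet_singleton _

section
variable {N : ℕ} {s pm r e : ℝ} {p : Euc N → Euc N → ℝ} {rs : ℝ} {q : Euc N → ℝ} {un : ℕ → Euc N → ℝ} {u : Euc N → ℝ}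
  {μ ν νb : Measure (Euc N)} {M : ℝ≥0∞}

lemma CH0.concl (h : CH0 s pm r e p rs q un u μ ν M) :
    ∃ (I : Set ℕ) (xi : ℕ → Euc N) (mui nui : ℕ → ℝ),
      (∀ i ∈ I, ∀ j ∈ I, i ≠ j → xi i ≠ xi j) ∧
      (∀ i ∈ I, q (xi i) = rs) ∧
      (∀ i ∈ I, 0 < mui i) ∧ (∀ i ∈ I, 0 < nui i) ∧
      (volume.withDensity (UE s p r u) +
        Measure.sum (fun i : I => ENNReal.ofReal (mui i.1) • Measure.dirac (xi i.1)) ≤ μ) ∧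
      (ν = volume.withDensity (fun x => ENNReal.ofReal (|u x| ^ q x)) +
        Measure.sum (fun i : I => ENNReal.ofReal (nui i.1) • Measure.dirac (xi i.1))) ∧
      (∀ i ∈ I, Sq s p q * nui i ^ (1 / rs) ≤ mui i ^ (1 / r)) := by
  obtain ⟨ns, hns, hae⟩ := h.subseq
  have h := h.sub hns
  have := h.fμ
  have := h.fν
  have hρν := h.fatouV hae
  set ρν := volume.withDensity (fun x => ENNReal.ofReal (|u x| ^ q x))
  have : IsFiniteMeasure ρν := ⟨(hρν univ).trans_lt (measure_lt_top ν univ)⟩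
  set νb := ν - ρν with hνb
  have hb : ν = ρν + νb := by rw [add_comm, hνb, Measure.sub_add_cancel_of_le hρν]
  have : IsFiniteMeasure νb := ⟨lt_of_le_of_lt (by
    have : νb ≤ ν := Measure.sub_le
    exact this univ) (measure_lt_top ν univ)⟩
  obtain ⟨a1, a2, a3⟩ := h.atoms hae hb
  set A : Set (Euc N) := {x | νb {x} ≠ 0} with hA
  have hAc : A.Countable := atoms_countable νb
  obtain ⟨f, hf⟩ := countable_iff_exists_injOn.1 hAc
  have hl := hf.leftInvOn_invFunOn
  set xi : ℕ → Euc N := Function.invFunOn f A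
  have hmem : ∀ i ∈ f '' A, xi i ∈ A := by
    rintro _ ⟨x, hx, rfl⟩; rw [hl hx]; exact hx
  have hinj : ∀ i ∈ f '' A, ∀ j ∈ f '' A, i ≠ j → xi i ≠ xi j := by
    rintro _ ⟨x, hx, rfl⟩ _ ⟨y, hy, rfl⟩ hij
    rw [hl hx, hl hy]
    rintro rfl; exact hij rfl
  have himg : xi '' (f '' A) = A := hl.image_image
  refine ⟨f '' A, xi, fun i => (μ {xi i}).toReal, fun i => (νb {xi i}).toReal, hinj, ?_, ?_, ?_, ?_, ?_, ?_⟩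
  · exact fun i hi => a3 _ (hmem i hi)
  · exact fun i hi => ENNReal.toReal_pos (a2 _ (hmem i hi)) (measure_ne_top _ _)
  · exact fun i hi => ENNReal.toReal_pos (hmem i hi) (measure_ne_top _ _)
  · rw [sum_atoms μ hinj himg]
    have hU := h.fatouU hae
    have hN : 0 < N := h.H.hN
    have hne : Nonempty (Fin N) := ⟨⟨0, hN⟩⟩
    have h0 : (volume.withDensity (UE s p r u)) A = 0 := withDensity_absolutelyContinuous _ _ (hAc.measure_zero _)
    set ρ := volume.withDensity (UE s p r u)
    have h1 : ρ = ρ.restrict Aᶜ := by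
      symm; apply Measure.restrict_eq_self_of_ae_mem
      exact measure_eq_zero_iff_ae_notMem.1 h0
    calc ρ + μ.restrict A = ρ.restrict Aᶜ + μ.restrict A := by rw [← h1]
      _ ≤ μ.restrict Aᶜ + μ.restrict A := by gcongr
      _ = μ := by rw [add_comm]; exact Measure.restrict_add_restrict_compl hAc.measurableSet
  · rw [sum_atoms νb hinj himg]
    have h1 : νb.restrict A = νb := by
      apply Measure.restrict_eq_self_of_ae_mem
      filter_upwards [measure_eq_zero_iff_ae_notMem.1 a1] with x hx using hx
    rw [h1]; exact hb
  · exact fun i hi => h.sq2 hae hb (a3 _ (hmem i hi))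
end

lemma kint_congr {N : ℕ} {s : ℝ} {p : Euc N → Euc N → ℝ} {f g : Euc N → ℝ} (h : f =ᵐ[volume] g) {x : Euc N} (hx : f x = g x) :
    ∫⁻ y, sobKernel s p f x y = ∫⁻ y, sobKernel s p g x y := by
  apply lintegral_congr_ae
  filter_upwards [h] with y hy
  simp only [sobKernel, hx, hy]

lemma UE_congr {N : ℕ} {s r : ℝ} {p : Euc N → Euc N → ℝ} {f g : Euc N → ℝ} (h : f =ᵐ[volume] g) :
    UE s p r f =ᵐ[volume] UE s p r g := by
  filter_upwards [h] with x hx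
  simp only [UE, kint_congr h hx, hx]

lemma mod_congr {N : ℕ} {s : ℝ} {p : Euc N → Euc N → ℝ} {f g : Euc N → ℝ} (h : f =ᵐ[volume] g) :
    sobModular univ s p f = sobModular univ s p g := by
  simp only [sobModular, Measure.restrict_univ]
  congr 1
  · apply lintegral_congr_ae
    filter_upwards [h] with x hx
    simp only [hx]
  · apply lintegral_congr_ae
    filter_upwards [h] with x hx
    exact kint_congr h hx

lemma Ufun_UE {N : ℕ} {s pm r e : ℝ} {p : Euc N → Euc N → ℝ} (H : PH s pm r e p) {f g : Euc N → ℝ} (hg : Measurable g)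
    (h : f =ᵐ[volume] g) (hfin : sobModular univ s p g < ⊤) :
    ∀ᵐ x, Ufun s p r f x = (UE s p r g x).toReal ∧ UE s p r g x ≠ ⊤ := by
  have h1 : ∀ᵐ x, UE s p r g x < ⊤ := ae_lt_top (measurable_UE H hg) (by rw [lintegral_UE H hg]; exact hfin.ne)
  filter_upwards [h, h1] with x hx hx1
  refine ⟨?_, hx1.ne⟩
  have h2 : ∫⁻ y, sobKernel s p g x y ≠ ⊤ := (lt_of_le_of_lt le_add_self hx1).ne
  rw [Ufun, UE, ENNReal.toReal_add ENNReal.ofReal_ne_top h2, ENNReal.toReal_ofReal (by positivity), kint_congr h hx, hx]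

lemma conv_test {N : ℕ} {φ : Euc N → ℝ} (hφ : CT φ) {σ : Measure (Euc N)} [IsFiniteMeasure σ] {F : ℕ → Euc N → ℝ}
    {G : ℕ → Euc N → ℝ≥0∞} (mG : ∀ n, Measurable (G n)) (hFG : ∀ n, ∀ᵐ x, F n x = (G n x).toReal)
    (fin : ∀ n, ∫⁻ x, ENNReal.ofReal (φ x) * G n x ≠ ⊤) (hw : WeakStarConv F σ) :
    Tendsto (fun n => ∫⁻ x, ENNReal.ofReal (φ x) * G n x) atTop (𝓝 (∫⁻ x, ENNReal.ofReal (φ x) ∂σ)) := by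
  have hφm := hφ.cont.measurable
  rw [← ENNReal.tendsto_toReal_iff fin (hφ.int_fin σ).ne]
  have hcc : Tendsto φ (cocompact (Euc N)) (𝓝 0) := by
    obtain ⟨R, hR, hs⟩ := hφ.supp
    refine tendsto_const_nhds.congr' ?_
    filter_upwards [(isCompact_closedBall (0 : Euc N) R).compl_mem_cocompact] with x hx
    by_contra h0
    exact hx (Metric.ball_subset_closedBall (hs x (Ne.symm h0)))
  have h1 := hw φ hφ.cont hcc
  have e1 : ∫ x, φ x ∂σ = (∫⁻ x, ENNReal.ofReal (φ x) ∂σ).toReal :=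
    integral_eq_lintegral_of_nonneg_ae (ae_of_all _ hφ.nonneg) hφm.aestronglyMeasurable
  rw [e1] at h1
  refine h1.congr fun n => ?_
  have m1 : Measurable fun x => ENNReal.ofReal (φ x) * G n x := hφm.ennreal_ofReal.mul (mG n)
  rw [← integral_toReal m1.aemeasurable (ae_lt_top m1 (fin n))]
  apply integral_congr_ae
  filter_upwards [hFG n] with x hx
  rw [ENNReal.toReal_mul, ENNReal.toReal_ofReal (hφ.nonneg x), hx]

/-- Theorem 4.2: the concentration-compactness principle for
the fractional Sobolev space with variable exponents on the whole space. -/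
theorem concentration_compactness {N : ℕ}
    (s pminus pbar ε₀ : ℝ) (hs : s ∈ Set.Ioo (0 : ℝ) 1)
    (p : Euc N → Euc N → ℝ) (pstar : Euc N → ℝ)
    (hpuc : UniformContinuous fun z : Euc N × Euc N => p z.1 z.2)
    (hpsym : ∀ x y, p x y = p y x)
    (hpminus : IsGLB (Set.range fun z : Euc N × Euc N => p z.1 z.2) pminus)
    (hpbar : IsLUB (Set.range fun z : Euc N × Euc N => p z.1 z.2) pbar)
    (hpm1 : 1 < pminus) (hpbarN : pbar < (N : ℝ) / s)
    (hε₀ : ε₀ ∈ Set.Ioo (0 : ℝ) (1 / 2))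
    (hdiag : ∀ x y : Euc N, dist x y < ε₀ → p x y = pbar)
    (hsupx : ∀ x : Euc N, IsLUB (Set.range (p x)) pbar)
    (hpstar : ∀ x : Euc N, IsGLB (Set.range (p x)) (pstar x))
    (hfin : volume {x : Euc N | pstar x ≠ pbar} < ⊤)
    (q : Euc N → ℝ) (hquc : UniformContinuous q)
    (pbarS : ℝ) (hpbarS : pbarS = (N : ℝ) * pbar / ((N : ℝ) - s * pbar))
    (hqlb : ∀ x, pstar x ≤ q x) (hqub : ∀ x, q x ≤ pbarS)
    (hqcrit : {x : Euc N | q x = pbarS}.Nonempty)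
    (un : ℕ → Euc N → ℝ) (u : Euc N → ℝ)
    (hmem : ∀ n, MemSob Set.univ s p (un n)) (humem : MemSob Set.univ s p u)
    (hbdd : ∃ C : ℝ, ∀ n, sobNorm Set.univ s p (un n) ≤ C)
    (hweak : WeakConvSob s p un u)
    (μ ν : Measure (Euc N)) (hμfin : IsFiniteMeasure μ) (hνfin : IsFiniteMeasure ν)
    (hμ : WeakStarConv (fun n => Ufun s p pbar (un n)) μ)
    (hν : WeakStarConv (fun n x => |un n x| ^ q x) ν) :
    ∃ (I : Set ℕ) (xi : ℕ → Euc N) (mui nui : ℕ → ℝ),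
      (∀ i ∈ I, ∀ j ∈ I, i ≠ j → xi i ≠ xi j) ∧
      (∀ i ∈ I, q (xi i) = pbarS) ∧
      (∀ i ∈ I, 0 < mui i) ∧ (∀ i ∈ I, 0 < nui i) ∧
      (volume.withDensity (fun x => ENNReal.ofReal (Ufun s p pbar u x)) +
        Measure.sum (fun i : I => ENNReal.ofReal (mui i.1) • Measure.dirac (xi i.1)) ≤ μ) ∧
      (ν = volume.withDensity (fun x => ENNReal.ofReal (|u x| ^ q x)) +
        Measure.sum (fun i : I => ENNReal.ofReal (nui i.1) • Measure.dirac (xi i.1))) ∧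
      (∀ i ∈ I, Sq s p q * nui i ^ (1 / pbarS) ≤ mui i ^ (1 / pbar)) := by
  have hpm_le : ∀ x y, pminus ≤ p x y := fun x y => hpminus.1 ⟨(x, y), rfl⟩
  have hle_pb : ∀ x y, p x y ≤ pbar := fun x y => hpbar.1 ⟨(x, y), rfl⟩
  have hpr : pminus ≤ pbar := (hpm_le 0 0).trans (hle_pb 0 0)
  have hs0 := hs.1
  have hsr : s * pbar < N := by rw [lt_div_iff₀ hs0] at hpbarN; linarith
  have hN : 0 < N := by
    rcases Nat.eq_zero_or_pos N with h0 | h0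
    · exfalso
      have h1 : (N : ℝ) = 0 := by exact_mod_cast h0
      have : 0 < s * pbar := mul_pos hs0 (by linarith)
      linarith
    · exact h0
  have H : PH s pminus pbar ε₀ p := ⟨hN, hs.1, hs.2, hpm1, hpr, hsr, hε₀.1, by linarith [hε₀.2], hpuc.continuous, hpsym, hpm_le, hle_pb, hdiag⟩
  have hql : ∀ x, pminus ≤ q x := by
    intro x
    refine le_trans ((hpstar x).2 ?_) (hqlb x)
    rintro _ ⟨y, rfl⟩; exact hpm_le x y
  have hmem' : ∀ n, AEStronglyMeasurable (un n) volume := fun n => by simpa using (hmem n).1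
  have hum : AEStronglyMeasurable u volume := by simpa using humem.1
  have hmk : ∀ n, ∃ g : Euc N → ℝ, Measurable g ∧ un n =ᵐ[volume] g :=
    fun n => ⟨(hmem' n).mk _, (hmem' n).stronglyMeasurable_mk.measurable, (hmem' n).ae_eq_mk⟩
  choose vn mvn hvn using hmk
  obtain ⟨v, mv, hv⟩ : ∃ g : Euc N → ℝ, Measurable g ∧ u =ᵐ[volume] g :=
    ⟨hum.mk _, hum.stronglyMeasurable_mk.measurable, hum.ae_eq_mk⟩
  obtain ⟨C, hC⟩ := hbdd
  have hmodn : ∀ n, sobModular univ s p (vn n) < ⊤ := fun n => by rw [← mod_congr (hvn n)]; exact (hmem n).2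
  have hmodv : sobModular univ s p v < ⊤ := by rw [← mod_congr hv]; exact humem.2
  have h : CH0 s pminus pbar ε₀ p pbarS q vn v μ ν
      (ENNReal.ofReal ((max 1 (C + 1)) ^ pbar) + sobModular univ s p v) := by
    refine ⟨H, hpbarS, hquc.continuous, hql, hqub, mvn, mv, ?_, ?_, ?_, ?_, hμfin, hνfin, ?_, ?_⟩
    · exact ENNReal.add_ne_top.2 ⟨ENNReal.ofReal_ne_top, hmodv.ne⟩
    · intro n
      rw [← mod_congr (hvn n)]
      exact (mod_bound H (hmem n).2 (hC n)).trans le_self_add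
    · exact le_add_self
    · intro x ε hε
      have h1 := hweak _ (ball_func H x ε)
      have h2 := h1.sub (tendsto_const_nhds (x := ∫ y in Metric.ball x ε, u y))
      rw [sub_self] at h2
      refine h2.congr fun n => ?_
      rw [← integral_sub (ball_int H (hmem n) x ε).1 (ball_int H humem x ε).1]
      apply integral_congr_ae
      filter_upwards [ae_restrict_of_ae (hvn n), ae_restrict_of_ae hv] with y h1 h2
      rw [h1, h2]
    · intro φ hφ
      refine conv_test hφ (fun n => measurable_UE H (mvn n)) (fun n => ?_) (fun n => ?_) hμ
      · filter_upwards [Ufun_UE H (mvn n) (hvn n) (hmodn n)] with x hx using hx.1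
      · refine (lt_of_le_of_lt (lintegral_mono fun x => ?_) ((lintegral_UE H (mvn n)).trans_lt (hmodn n))).ne
        exact mul_le_of_le_one_left zero_le (ENNReal.ofReal_le_one.2 (hφ.le_one x))
    · intro φ hφ
      have hφm := hφ.cont.measurable
      have hqm := hquc.continuous.measurable
      have hr : 1 < pbar := by linarith
      have mq : ∀ n, Measurable fun x => ENNReal.ofReal (|vn n x| ^ q x) := by
        intro n
        have := mvn n
        fun_prop
      refine conv_test hφ mq (fun n => ?_) (fun n => ?_) hν
      · filter_upwards [hvn n] with x hx
        rw [hx, ENNReal.toReal_ofReal (by positivity)]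
      · obtain ⟨C', hC', -, hS⟩ := sobolev_ineq hN hs0 hr hsr hpbarS hε₀.1
        have h1 : ∫⁻ y, ENNReal.ofReal (|vn n y| ^ pbarS) < ⊤ := by
          refine (hS _ (mvn n)).trans_lt ?_
          have h2 : ∫⁻ x, Gf s pbar ε₀ (vn n) x < ⊤ :=
            (lintegral_mono fun x => Gf_le_UE H _ _).trans_lt ((lintegral_UE H (mvn n)).trans_lt (hmodn n))
          have h3 : 0 ≤ pbarS / pbar := by
            have : 0 ≤ pbarS := by linarith [hql 0, hqub 0]
            exact div_nonneg this (by linarith)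
          exact ENNReal.mul_lt_top hC'.lt_top (ENNReal.rpow_lt_top_of_nonneg h3 h2.ne)
        obtain ⟨R, hR, hsup⟩ := hφ.supp
        have h2 : ∫⁻ x, ENNReal.ofReal (φ x) < ⊤ :=
          (test_upper measurableSet_ball hφ.le_one hsup volume).trans_lt measure_ball_lt_top
        have h3 : ∫⁻ x, (ENNReal.ofReal (φ x) + ENNReal.ofReal (|vn n x| ^ pbarS)) < ⊤ := by
          rw [lintegral_add_left hφm.ennreal_ofReal]
          exact ENNReal.add_lt_top.2 ⟨h2, h1⟩
        refine (lt_of_le_of_lt (lintegral_mono fun x => ?_) h3).ne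
        have hφ0 := hφ.nonneg x
        have hφ1 := hφ.le_one x
        rw [← ENNReal.ofReal_mul hφ0, ← ENNReal.ofReal_add hφ0 (by positivity)]
        apply ENNReal.ofReal_le_ofReal
        have h4 := rpow_le_two (abs_nonneg (vn n x)) le_rfl (show 0 ≤ q x by linarith [hql x]) (hqub x)
        rw [Real.rpow_zero] at h4
        have h5 : 0 ≤ |vn n x| ^ pbarS := by positivity
        nlinarith [mul_le_mul_of_nonneg_left h4 hφ0]
  obtain ⟨I, xi, mui, nui, c1, c2, c3, c4, c5, c6, c7⟩ := h.concl
  refine ⟨I, xi, mui, nui, c1, c2, c3, c4, ?_, ?_, c7⟩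
  · have : volume.withDensity (fun x => ENNReal.ofReal (Ufun s p pbar u x)) = volume.withDensity (UE s p pbar v) := by
      apply withDensity_congr_ae
      filter_upwards [Ufun_UE H mv hv hmodv] with x hx
      rw [hx.1, ENNReal.ofReal_toReal hx.2]
    rw [this]; exact c5
  · have : volume.withDensity (fun x => ENNReal.ofReal (|u x| ^ q x)) = volume.withDensity (fun x => ENNReal.ofReal (|v x| ^ q x)) := by
      apply withDensity_congr_ae
      filter_upwards [hv] with x hx
      rw [hx]
    rw [this]; exact c6
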